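/- Let η_R and η̄_R be cutoffs as in the standard cutoff setup, let s ∈ [0,1], κ ∈ ℝ, e ∈ ℝ^n with |e| = 1, and u ∈ C^∞(ℝ^n) ∩ W^{2,∞}(ℝ^n). For x ∈ ℝ^n set φ(x) := η̄_R²(x)(∂²_e u(x))₊² + τ R^{-2} η_R²(x)(∂_e u(x))² + σ R^{-4} (u(x) − κ)². Then there exist positive constants σ₀ and τ₀, depending only on n, ‖η‖_{C²(ℝ^n)}, and ‖η̄‖_{C²(ℝ^n)}, such that if τ ≥ τ₀ and σ ≥ σ₀ τ, then everywhere in ℝ^n, (-Δ)^s φ ≤ 2 η̄_R² (∂²_e u)₊ (-Δ)^s ∂²_e u + 2 τ R^{-2} η_R² ∂_e u (-Δ)^s ∂_e u + 2 σ R^{-4} (u − κ) (-Δ)^s (u − κ). -/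

import Mathlib

open MeasureTheory Filter Metric Set

noncomputable section

/-- Euclidean space `ℝⁿ`. -/
abbrev En (n : ℕ) := EuclideanSpace ℝ (Fin n)

/-- Principal value integral centered at `x`: the limit, as `ε → 0⁺`, of the integrals
over the complement of the `ε`-ball centered at `x`. -/
def pvAt (n : ℕ) (x : En n) (g : En n → ℝ) : ℝ :=
  limUnder (nhdsWithin (0:ℝ) (Set.Ioi 0))
    (fun ε => ∫ y in {y : En n | ε ≤ dist y x}, g y)

/-- Integro-differential operator with kernel `K`:
`𝓛_K u (x) = P.V. ∫ (u x - u y) K (x - y) dy`. -/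
def opK (n : ℕ) (K : En n → ℝ) (u : En n → ℝ) (x : En n) : ℝ :=
  pvAt n x (fun y => (u x - u y) * K (x - y))

/-- The normalizing constant `c_{n,s}` of the fractional Laplacian, for which the
Fourier symbol is `|ξ|^{2s}`. -/
def cns (n : ℕ) (s : ℝ) : ℝ :=
  (4:ℝ) ^ s * s * Real.Gamma ((n:ℝ)/2 + s) / (Real.pi ^ ((n:ℝ)/2) * Real.Gamma (1 - s))

/-- The fractional Laplacian `(-Δ)^s`, for `s ∈ (0,1)`. -/
def fracLap (n : ℕ) (s : ℝ) (u : En n → ℝ) (x : En n) : ℝ :=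
  opK n (fun z => cns n s * ‖z‖ ^ (-((n:ℝ) + 2*s))) u x

/-- Directional derivative `∂_e u`. -/
def dd (n : ℕ) (e : En n) (u : En n → ℝ) (x : En n) : ℝ := fderiv ℝ u x e

/-- Second directional derivative `∂²_e u`. -/
def dd2 (n : ℕ) (e : En n) (u : En n → ℝ) (x : En n) : ℝ := fderiv ℝ (dd n e u) x e

/-- `‖η‖_{C²(ℝⁿ)} ≤ M`. -/
def C2BddBy (n : ℕ) (η : En n → ℝ) (M : ℝ) : Prop :=
  ∀ x : En n, |η x| ≤ M ∧ ‖fderiv ℝ η x‖ ≤ M ∧ ‖fderiv ℝ (fderiv ℝ η) x‖ ≤ M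

/-- The kernel `K` is even and has two-sided power bounds with constants `C₁ ≤ C₂`:
`K(z) = K(-z)` and `C₁ s(1-s)|z|^{-n-2s} ≤ K(z) ≤ C₂ s(1-s)|z|^{-n-2s}` for `z ≠ 0`. -/
def evenPowKernel (n : ℕ) (s C₁ C₂ : ℝ) (K : En n → ℝ) : Prop :=
  (∀ z : En n, z ≠ 0 → K z = K (-z)) ∧
  (∀ z : En n, z ≠ 0 →
    C₁ * (s * (1 - s)) * ‖z‖ ^ (-((n:ℝ) + 2*s)) ≤ K z ∧
    K z ≤ C₂ * (s * (1 - s)) * ‖z‖ ^ (-((n:ℝ) + 2*s)))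

/-- `K ∈ C²(ℝⁿ \ {0})` with `|z||∇K(z)| + |z|²|D²K(z)| ≤ C₃ K(z)` for `z ≠ 0`. -/
def kernelDerivBdd (n : ℕ) (C₃ : ℝ) (K : En n → ℝ) : Prop :=
  ContDiffOn ℝ 2 K {z : En n | z ≠ 0} ∧
  ∀ z : En n, z ≠ 0 →
    ‖z‖ * ‖fderiv ℝ K z‖ + ‖z‖^2 * ‖fderiv ℝ (fderiv ℝ K) z‖ ≤ C₃ * K z

/-- `(-Δ) u (x)` computed through the liminf of second incremental quotients
(which equals `-Δu(x)` whenever `u` is `C²` near `x`). -/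
def negLapInc (n : ℕ) (u : En n → ℝ) (x : En n) : ℝ :=
  Filter.liminf (fun h : ℝ =>
      ∑ i : Fin n, (2 * u x - u (x + h • EuclideanSpace.single i 1)
        - u (x - h • EuclideanSpace.single i 1)) / h ^ 2)
    (nhdsWithin (0:ℝ) (Set.Ioi 0))

/-- The fractional Laplacian `(-Δ)^s` for `s ∈ [0,1]`, with the conventions
`(-Δ)^0 = Id` and `(-Δ)^1 = -Δ` (the latter via second incremental quotients). -/
def fracLapE (n : ℕ) (s : ℝ) (u : En n → ℝ) (x : En n) : ℝ :=
  if s = 0 then u x else if s = 1 then negLapInc n u x else fracLap n s u x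

/-- The operator `𝓛_μ u (x) = ∫₀¹ (-Δ)^s u (x) dμ(s)` for a measure `μ` on `[0,1]`. -/
def opMu (n : ℕ) (μ : Measure ℝ) (u : En n → ℝ) (x : En n) : ℝ :=
  ∫ s, fracLapE n s u x ∂μ

/-- The unnormalized standard Gaussian weight. -/
def gaussWeight (n : ℕ) (z : En n) : ℝ := Real.exp (-(‖z‖ ^ 2 / 2))

/-- The total mass of the Gaussian weight. -/
def gaussMass (n : ℕ) : ℝ := ∫ z : En n, gaussWeight n z

/-- The standard Gaussian probability measure. -/
def gaussM (n : ℕ) : Measure (En n) :=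
  volume.withDensity (fun z => ENNReal.ofReal ((gaussMass n)⁻¹ * gaussWeight n z))

lemma continuous_gaussWeight (n : ℕ) : Continuous (gaussWeight n) := by
  unfold gaussWeight; fun_prop

lemma gaussWeight_pos (n : ℕ) (z : En n) : 0 < gaussWeight n z := Real.exp_pos _

lemma integrable_exp_neg_mul_norm_sq (n : ℕ) {b : ℝ} (hb : 0 < b) :
    Integrable (fun z : En n => Real.exp (-b * ‖z‖ ^ 2)) := by
  have h := GaussianFourier.integrable_cexp_neg_mul_sq_norm_add (V := En n) (b := (b : ℂ))
    (by simpa using hb) 0 0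
  have h2 := h.norm
  refine h2.congr (Eventually.of_forall fun z => ?_)
  simp only [Complex.norm_exp]
  congr 1
  simp only [inner_zero_left, Complex.ofReal_zero, mul_zero, add_zero]
  rw [← Complex.ofReal_pow, ← Complex.ofReal_neg, ← Complex.ofReal_mul, Complex.ofReal_re]

lemma integrable_pow_mul_gaussWeight (n k : ℕ) :
    Integrable (fun z : En n => (1 + ‖z‖) ^ k * gaussWeight n z) := by
  have h := (integrable_exp_neg_mul_norm_sq n (b := 1 / 4) (by norm_num)).const_mul
    ((Nat.factorial k : ℝ) * Real.exp 2)
  refine h.mono' ?_ (Eventually.of_forall fun z => ?_)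
  · exact (Continuous.mul (by fun_prop) (continuous_gaussWeight n)).aestronglyMeasurable
  · have h1 : 0 ≤ 1 + ‖z‖ := by positivity
    have h2 := Real.pow_div_factorial_le_exp (1 + ‖z‖) h1 k
    have h3 : (1 + ‖z‖) ^ k ≤ (Nat.factorial k : ℝ) * Real.exp (1 + ‖z‖) := by
      rw [div_le_iff₀ (by positivity)] at h2
      linarith
    rw [Real.norm_of_nonneg (mul_nonneg (by positivity) (gaussWeight_pos n z).le)]
    calc (1 + ‖z‖) ^ k * gaussWeight n z
        ≤ (Nat.factorial k : ℝ) * Real.exp (1 + ‖z‖) * gaussWeight n z :=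
          mul_le_mul_of_nonneg_right h3 (gaussWeight_pos n z).le
      _ = (Nat.factorial k : ℝ) * Real.exp (1 + ‖z‖ + -(‖z‖ ^ 2 / 2)) := by
          rw [gaussWeight, Real.exp_add (1 + ‖z‖)]; ring
      _ ≤ (Nat.factorial k : ℝ) * Real.exp (2 + -(1/4) * ‖z‖ ^ 2) := by
          refine mul_le_mul_of_nonneg_left (Real.exp_le_exp.2 ?_) (by positivity)
          nlinarith [sq_nonneg (‖z‖ - 2)]
      _ = _ := by rw [Real.exp_add]; ring

lemma integrable_gaussWeight (n : ℕ) : Integrable (gaussWeight n) := by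
  simpa using integrable_pow_mul_gaussWeight n 0

lemma gaussMass_pos (n : ℕ) : 0 < gaussMass n := by
  unfold gaussMass
  rw [integral_pos_iff_support_of_nonneg (fun z => (gaussWeight_pos n z).le)
    (integrable_gaussWeight n)]
  have : Function.support (gaussWeight n) = univ := by
    ext z; simp [(gaussWeight_pos n z).ne']
  rw [this]
  exact Measure.measure_univ_pos.2 (NeZero.ne _)

lemma integral_gaussM (n : ℕ) (f : En n → ℝ) :
    ∫ z, f z ∂(gaussM n) = (gaussMass n)⁻¹ * ∫ z, f z * gaussWeight n z := by
  have hp : ∀ z, 0 ≤ (gaussMass n)⁻¹ * gaussWeight n z := fun z =>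
    mul_nonneg (inv_nonneg.2 (gaussMass_pos n).le) (gaussWeight_pos n z).le
  unfold gaussM
  rw [integral_withDensity_eq_integral_toReal_smul]
  · rw [← integral_const_mul]
    congr 1
    ext z
    rw [ENNReal.toReal_ofReal (hp z), smul_eq_mul]
    ring
  · exact ((continuous_const.mul (continuous_gaussWeight n)).measurable).ennreal_ofReal
  · exact Eventually.of_forall fun z => ENNReal.ofReal_lt_top

lemma integrable_gaussM_iff (n : ℕ) (f : En n → ℝ) :
    Integrable f (gaussM n) ↔ Integrable (fun z => f z * gaussWeight n z) := by
  have hp : ∀ z, 0 ≤ (gaussMass n)⁻¹ * gaussWeight n z := fun z =>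
    mul_nonneg (inv_nonneg.2 (gaussMass_pos n).le) (gaussWeight_pos n z).le
  unfold gaussM
  rw [integrable_withDensity_iff]
  · have h := gaussMass_pos n
    rw [← integrable_const_mul_iff (c := (gaussMass n)⁻¹)
      (isUnit_iff_ne_zero.2 (inv_ne_zero h.ne')) (fun z => f z * gaussWeight n z)]
    refine integrable_congr (Eventually.of_forall fun z => ?_)
    simp only [ENNReal.toReal_ofReal (hp z)]
    ring
  · exact ((continuous_const.mul (continuous_gaussWeight n)).measurable).ennreal_ofReal
  · exact Eventually.of_forall fun z => ENNReal.ofReal_lt_top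

instance isProbabilityMeasure_gaussM (n : ℕ) : IsProbabilityMeasure (gaussM n) := by
  have h1 : Integrable (fun _ : En n => (1 : ℝ)) (gaussM n) := by
    rw [integrable_gaussM_iff]; simpa using integrable_gaussWeight n
  have h2 : ∫ _ : En n, (1 : ℝ) ∂(gaussM n) = 1 := by
    rw [integral_gaussM]
    simp only [one_mul]
    exact inv_mul_cancel₀ (gaussMass_pos n).ne'
  rw [integral_const, smul_eq_mul, mul_one] at h2
  constructor
  have := (ENNReal.toReal_eq_one_iff _).1 h2
  exact this

/-- Continuous functions of at most polynomial growth. -/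
def Tame (n : ℕ) (f : En n → ℝ) : Prop :=
  Continuous f ∧ ∃ (C : ℝ) (k : ℕ), ∀ z, |f z| ≤ C * (1 + ‖z‖) ^ k

namespace Tame
variable {n : ℕ} {f g : En n → ℝ}

lemma of_bound (hf : Continuous f) {C : ℝ} {k : ℕ} (h : ∀ z, |f z| ≤ C * (1 + ‖z‖) ^ k) :
    Tame n f := ⟨hf, C, k, h⟩

lemma of_bdd (hf : Continuous f) {C : ℝ} (h : ∀ z, |f z| ≤ C) : Tame n f :=
  ⟨hf, C, 0, by simpa using h⟩

lemma const (c : ℝ) : Tame n (fun _ => c) := of_bdd continuous_const fun _ => le_refl |c|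

lemma mul (hf : Tame n f) (hg : Tame n g) : Tame n (fun z => f z * g z) := by
  obtain ⟨hf, C, k, h⟩ := hf
  obtain ⟨hg, C', k', h'⟩ := hg
  refine ⟨hf.mul hg, C * C', k + k', fun z => ?_⟩
  rw [abs_mul]
  calc |f z| * |g z| ≤ (C * (1 + ‖z‖) ^ k) * (C' * (1 + ‖z‖) ^ k') :=
        mul_le_mul (h z) (h' z) (abs_nonneg _) ((abs_nonneg _).trans (h z))
    _ = _ := by rw [pow_add]; ring

lemma add (hf : Tame n f) (hg : Tame n g) : Tame n (fun z => f z + g z) := by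
  obtain ⟨hf, C, k, h⟩ := hf
  obtain ⟨hg, C', k', h'⟩ := hg
  refine ⟨hf.add hg, C + C', max k k', fun z => ?_⟩
  have h1 : (1 : ℝ) ≤ 1 + ‖z‖ := by linarith [norm_nonneg z]
  have hC : 0 ≤ C := nonneg_of_mul_nonneg_left ((abs_nonneg _).trans (h z)) (by positivity)
  have hC' : 0 ≤ C' := nonneg_of_mul_nonneg_left ((abs_nonneg _).trans (h' z)) (by positivity)
  calc |f z + g z| ≤ |f z| + |g z| := abs_add_le _ _
    _ ≤ C * (1 + ‖z‖) ^ k + C' * (1 + ‖z‖) ^ k' := add_le_add (h z) (h' z)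
    _ ≤ C * (1 + ‖z‖) ^ (max k k') + C' * (1 + ‖z‖) ^ (max k k') := by
        gcongr
        · exact le_max_left _ _
        · exact le_max_right _ _
    _ = _ := by ring

lemma neg (hf : Tame n f) : Tame n (fun z => -f z) := by
  simpa using (const (-1)).mul hf

lemma sub (hf : Tame n f) (hg : Tame n g) : Tame n (fun z => f z - g z) := by
  simpa [sub_eq_add_neg] using hf.add hg.neg

lemma sq (hf : Tame n f) : Tame n (fun z => f z ^ 2) := by
  simpa [_root_.sq] using hf.mul hf

lemma pos_part (hf : Tame n f) : Tame n (fun z => max (f z) 0) := by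
  obtain ⟨hf, C, k, h⟩ := hf
  refine ⟨hf.max continuous_const, C, k, fun z => le_trans ?_ (h z)⟩
  rw [abs_of_nonneg (le_max_right _ _)]
  exact max_le (le_abs_self _) (abs_nonneg _)

lemma inner_right (e : En n) : Tame n (fun z => inner ℝ z e) := by
  refine ⟨by fun_prop, ‖e‖, 1, fun z => ?_⟩
  calc |inner ℝ z e| ≤ ‖z‖ * ‖e‖ := abs_real_inner_le_norm z e
    _ ≤ _ := by nlinarith [norm_nonneg z, norm_nonneg e]

lemma integrable_mul (hf : Tame n f) : Integrable (fun z => f z * gaussWeight n z) := by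
  obtain ⟨hf, C, k, h⟩ := hf
  refine ((integrable_pow_mul_gaussWeight n k).const_mul C).mono'
    (hf.mul (continuous_gaussWeight n)).aestronglyMeasurable (Eventually.of_forall fun z => ?_)
  rw [norm_mul, Real.norm_eq_abs, Real.norm_of_nonneg (gaussWeight_pos n z).le, ← mul_assoc]
  exact mul_le_mul_of_nonneg_right (h z) (gaussWeight_pos n z).le

lemma integrable (hf : Tame n f) : Integrable f (gaussM n) :=
  (integrable_gaussM_iff n f).2 hf.integrable_mul

end Tame

lemma hasFDerivAt_gaussWeight (n : ℕ) (z : En n) :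
    HasFDerivAt (gaussWeight n) (-(gaussWeight n z) • (innerSL ℝ z)) z := by
  have h1 : HasFDerivAt (fun z : En n => ‖z‖ ^ 2) (2 • (innerSL ℝ z)) z :=
    (hasStrictFDerivAt_norm_sq z).hasFDerivAt
  have h2 : HasDerivAt (fun t : ℝ => Real.exp (-(t / 2)))
      (Real.exp (-(‖z‖ ^ 2 / 2)) * (-(1 / 2))) (‖z‖ ^ 2) :=
    (((hasDerivAt_id _).div_const 2).neg).exp
  have h3 := h2.comp_hasFDerivAt z h1
  refine h3.congr_fderiv ?_
  ext y
  simp [gaussWeight]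
  ring

lemma fderiv_gaussWeight (n : ℕ) (z e : En n) :
    fderiv ℝ (gaussWeight n) z e = -(inner ℝ z e) * gaussWeight n z := by
  rw [(hasFDerivAt_gaussWeight n z).fderiv]
  simp
  ring

/-- Gaussian integration by parts. -/
lemma gauss_stein {n : ℕ} {f g : En n → ℝ} (e : En n) (hf : Differentiable ℝ f)
    (hg : Differentiable ℝ g) (tf : Tame n f) (tg : Tame n g)
    (tf' : Tame n (fun z => fderiv ℝ f z e)) (tg' : Tame n (fun z => fderiv ℝ g z e)) (c : ℝ) :
    ∫ z, f z * fderiv ℝ g z e ∂(gaussM n) =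
      ∫ z, (g z - c) * (f z * inner ℝ z e - fderiv ℝ f z e) ∂(gaussM n) := by
  have ti := Tame.inner_right e
  have hw : Differentiable ℝ (gaussWeight n) := fun z =>
    (hasFDerivAt_gaussWeight n z).differentiableAt
  have tc : Tame n (fun z => g z - c) := tg.sub (Tame.const c)
  have hder : ∀ z, fderiv ℝ (fun z => f z * gaussWeight n z) z e
      = (fderiv ℝ f z e - f z * inner ℝ z e) * gaussWeight n z := by
    intro z
    rw [fderiv_fun_mul (hf z) (hw z)]
    simp [fderiv_gaussWeight]
    ring
  have hder2 : ∀ z, fderiv ℝ (fun z => g z - c) z e = fderiv ℝ g z e := by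
    intro z; rw [fderiv_sub_const]
  have key := integral_mul_fderiv_eq_neg_fderiv_mul_of_integrable (μ := (volume : Measure (En n)))
    (f := fun z => f z * gaussWeight n z) (g := fun z => g z - c) (v := e) ?_ ?_ ?_ ?_ ?_
  · rw [integral_gaussM, integral_gaussM]
    congr 1
    simp only [hder, hder2] at key
    rw [← integral_neg] at key
    convert key using 1
    · congr 1; ext z; ring
    · congr 1; ext z; ring
  · simp only [hder]
    refine (((tf'.sub (tf.mul ti)).mul tc).integrable_mul).congr (Eventually.of_forall fun z => ?_)
    ring
  · simp only [hder2]
    refine ((tf.mul tg').integrable_mul).congr (Eventually.of_forall fun z => ?_)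
    ring
  · refine ((tf.mul tc).integrable_mul).congr (Eventually.of_forall fun z => ?_)
    ring
  · intro z _; exact (hf z).mul (hw z)
  · intro z _; exact (hg z).sub_const c

/-- Odd symmetry of the Gaussian measure. -/
lemma integral_gaussM_neg (n : ℕ) (f : En n → ℝ) :
    ∫ z, f (-z) ∂(gaussM n) = ∫ z, f z ∂(gaussM n) := by
  rw [integral_gaussM, integral_gaussM]
  congr 1
  rw [← integral_neg_eq_self (fun z => f z * gaussWeight n z)]
  simp [gaussWeight]

lemma integral_gaussM_clm (n : ℕ) (l : En n →L[ℝ] ℝ) : ∫ z, l z ∂(gaussM n) = 0 := by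
  have h := integral_gaussM_neg n l
  simp only [map_neg, integral_neg] at h
  linarith

/-- Cauchy--Schwarz. -/
lemma sq_integral_mul_le {α : Type*} [MeasurableSpace α] {μ : Measure α} {f g : α → ℝ}
    (hf : Integrable (fun z => f z ^ 2) μ) (hg : Integrable (fun z => g z ^ 2) μ)
    (hfg : Integrable (fun z => f z * g z) μ) :
    (∫ z, f z * g z ∂μ) ^ 2 ≤ (∫ z, f z ^ 2 ∂μ) * ∫ z, g z ^ 2 ∂μ := by
  have h : ∀ t : ℝ, 0 ≤ (∫ z, f z ^ 2 ∂μ) * (t * t) + (2 * ∫ z, f z * g z ∂μ) * t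
      + ∫ z, g z ^ 2 ∂μ := by
    intro t
    have : 0 ≤ ∫ z, (t * f z + g z) ^ 2 ∂μ := integral_nonneg fun z => sq_nonneg _
    have e : ∀ z, (t * f z + g z) ^ 2 = t ^ 2 * f z ^ 2 + (2 * t) * (f z * g z) + g z ^ 2 :=
      fun z => by ring
    simp only [e] at this
    have i1 : Integrable (fun z => t ^ 2 * f z ^ 2 + (2 * t) * (f z * g z)) μ :=
      (hf.const_mul _).add (hfg.const_mul _)
    rw [integral_add i1 hg, integral_add (hf.const_mul _) (hfg.const_mul _), integral_const_mul,
      integral_const_mul] at this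
    linarith
  have := discrim_le_zero h
  unfold discrim at this
  linarith

/-- A Gaussian moment which dominates all the constants depending on the dimension. -/
def gaussK (n : ℕ) : ℝ := ∫ z, (1 + ‖z‖) ^ 12 ∂(gaussM n)

lemma tame_pow (n k : ℕ) : Tame n (fun z => (1 + ‖z‖) ^ k) :=
  Tame.of_bound (C := 1) (k := k) (by fun_prop) fun z => by
    rw [abs_of_nonneg (by positivity), one_mul]

lemma one_le_gaussK (n : ℕ) : 1 ≤ gaussK n := by
  have h : ∫ _ : En n, (1 : ℝ) ∂(gaussM n) ≤ gaussK n :=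
    integral_mono (Tame.const 1).integrable (tame_pow n 12).integrable fun z =>
      one_le_pow₀ (by linarith [norm_nonneg z])
  simpa using h

lemma pow_le_weight {n : ℕ} (z : En n) {j k : ℕ} (h : j ≤ k) : ‖z‖ ^ j ≤ (1 + ‖z‖) ^ k := by
  have h0 := norm_nonneg z
  calc ‖z‖ ^ j ≤ (1 + ‖z‖) ^ j := by gcongr; linarith
    _ ≤ _ := pow_le_pow_right₀ (by linarith) h

lemma abs_integral_le_gaussK {n : ℕ} {f : En n → ℝ} {B : ℝ}
    (h : ∀ z, |f z| ≤ B * (1 + ‖z‖) ^ 12) :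
    |∫ z, f z ∂(gaussM n)| ≤ B * gaussK n := by
  have h1 := norm_integral_le_of_norm_le (μ := gaussM n) (f := f)
    ((tame_pow n 12).integrable.const_mul B) (Eventually.of_forall fun z => by
      rw [Real.norm_eq_abs]; exact h z)
  rwa [integral_const_mul, Real.norm_eq_abs] at h1

lemma abs_inner_le_norm_of_unit {n : ℕ} {e : En n} (he : ‖e‖ = 1) (z : En n) :
    |inner ℝ z e| ≤ ‖z‖ := by
  simpa [he] using abs_real_inner_le_norm z e

/-- Cauchy--Schwarz against a weight of polynomial growth. -/
lemma abs_integral_mul_le {n : ℕ} {f g : En n → ℝ} {B : ℝ} (hB : 0 ≤ B)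
    (tf : Tame n f) (tg : Tame n g) (h : ∀ z, |f z| ≤ B * (1 + ‖z‖) ^ 6) :
    |∫ z, g z * f z ∂(gaussM n)| ≤ B * √(gaussK n * ∫ z, g z ^ 2 ∂(gaussM n)) := by
  have h1 := sq_integral_mul_le tg.sq.integrable tf.sq.integrable (tg.mul tf).integrable
  have h2 : ∫ z, f z ^ 2 ∂(gaussM n) ≤ B ^ 2 * gaussK n := by
    unfold gaussK
    rw [← integral_const_mul]
    refine integral_mono tf.sq.integrable ((tame_pow n 12).integrable.const_mul _) fun z => ?_
    have := pow_le_pow_left₀ (abs_nonneg _) (h z) 2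
    rw [sq_abs] at this
    refine this.trans (le_of_eq ?_)
    ring
  have h3 : 0 ≤ ∫ z, g z ^ 2 ∂(gaussM n) := integral_nonneg fun z => sq_nonneg _
  have hK := one_le_gaussK n
  refine abs_le_of_sq_le_sq ?_ (by positivity)
  rw [mul_pow, Real.sq_sqrt (by positivity)]
  nlinarith

lemma stein_bound {n : ℕ} {e : En n} (he : ‖e‖ = 1) {f f' g : En n → ℝ} {B : ℝ} (hB : 0 ≤ B)
    (hf : Differentiable ℝ f) (hg : Differentiable ℝ g) (tg : Tame n g)
    (tg' : Tame n (fun z => fderiv ℝ g z e))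
    (hf' : ∀ z, fderiv ℝ f z e = f' z) (cf' : Continuous f')
    (b : ∀ z, |f z| ≤ B * (1 + ‖z‖) ^ 5) (b' : ∀ z, |f' z| ≤ B * (1 + ‖z‖) ^ 5) (c : ℝ) :
    |∫ z, f z * fderiv ℝ g z e ∂(gaussM n)| ≤
      2 * B * √(gaussK n * ∫ z, (g z - c) ^ 2 ∂(gaussM n)) := by
  have tf : Tame n f := Tame.of_bound hf.continuous b
  have tf' : Tame n f' := Tame.of_bound cf' b'
  have tf'' : Tame n (fun z => fderiv ℝ f z e) := by simpa only [hf'] using tf'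
  rw [gauss_stein e hf hg tf tg tf'' tg' c]
  refine abs_integral_mul_le (by positivity) ((tf.mul (Tame.inner_right e)).sub tf'')
    (tg.sub (Tame.const c)) fun z => ?_
  rw [hf' z]
  have h1 := abs_inner_le_norm_of_unit he z
  have h0 := norm_nonneg z
  have hp : 0 ≤ B * (1 + ‖z‖) ^ 5 := by positivity
  calc |f z * inner ℝ z e - f' z| ≤ |f z| * |inner ℝ z e| + |f' z| := by
        rw [← abs_mul]; exact abs_sub _ _
    _ ≤ (B * (1 + ‖z‖) ^ 5) * ‖z‖ + B * (1 + ‖z‖) ^ 5 :=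
        add_le_add (mul_le_mul (b z) h1 (abs_nonneg _) hp) (b' z)
    _ = B * (1 + ‖z‖) ^ 6 := by ring
    _ ≤ 2 * B * (1 + ‖z‖) ^ 6 := by
        have : 0 ≤ B * (1 + ‖z‖) ^ 6 := by positivity
        linarith

/-- Bounds for a cutoff at scale `r`. -/
structure CutoffBound (n : ℕ) (e : En n) (N r : ℝ) (c : En n → ℝ) : Prop where
  smooth : ContDiff ℝ 1 c
  bdd : ∀ z, |c z| ≤ N
  lip : ∀ z, |c z - c 0| ≤ N * r * ‖z‖
  der : ∀ z, |fderiv ℝ c z e| ≤ N * r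
  mean : |∫ z, c z ∂(gaussM n) - c 0| ≤ N * r ^ 2 * gaussK n

/-- A function, bounded together with its first two derivatives in direction `e`. -/
structure DirBound (n : ℕ) (e : En n) (g v w : En n → ℝ) : Prop where
  dg : Differentiable ℝ g
  dv : Differentiable ℝ v
  hv : ∀ z, fderiv ℝ g z e = v z
  hw : ∀ z, fderiv ℝ v z e = w z
  tg : Tame n g
  tv : Tame n v
  tw : Tame n w

namespace CutoffBound
variable {n : ℕ} {e : En n} {N r : ℝ} {c : En n → ℝ}

lemma diff (h : CutoffBound n e N r c) : Differentiable ℝ c := h.smooth.differentiable (by simp)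

lemma tame (h : CutoffBound n e N r c) : Tame n c := Tame.of_bdd h.smooth.continuous h.bdd

lemma continuous_der (h : CutoffBound n e N r c) : Continuous (fun z => fderiv ℝ c z e) :=
  (h.smooth.continuous_fderiv (by simp)).clm_apply continuous_const

lemma integral_sq_sub_le (h : CutoffBound n e N r c) :
    ∫ z, (c z - c 0) ^ 2 ∂(gaussM n) ≤ N ^ 2 * r ^ 2 * gaussK n := by
  refine (le_abs_self _).trans (abs_integral_le_gaussK fun z => ?_)
  rw [abs_of_nonneg (sq_nonneg _), ← sq_abs]
  calc |c z - c 0| ^ 2 ≤ (N * r * ‖z‖) ^ 2 := by gcongr; exact h.lip z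
    _ = N ^ 2 * r ^ 2 * ‖z‖ ^ 2 := by ring
    _ ≤ _ := by gcongr; exact pow_le_weight z (by norm_num)

end CutoffBound

section heat
variable {n : ℕ} {e : En n} {N r : ℝ} {g v w ζ a : En n → ℝ}

lemma DirBound.abs_integral_v_le (he : ‖e‖ = 1) (hg : DirBound n e g v w) (c : ℝ) :
    |∫ z, v z ∂(gaussM n)| ≤ 2 * √(gaussK n * ∫ z, (g z - c) ^ 2 ∂(gaussM n)) := by
  have h := stein_bound he (f := fun _ => 1) (f' := fun _ => 0) (B := 1) zero_le_one
    (by fun_prop) hg.dg hg.tg (by simpa only [hg.hv] using hg.tv) (by simp)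
    continuous_const (fun z => ?_) (fun z => ?_) c
  · simpa [hg.hv] using h
  · rw [abs_one, one_mul]; exact one_le_pow₀ (by linarith [norm_nonneg z])
  · rw [abs_zero]; positivity

lemma fderiv_inner_right (e z : En n) (he : ‖e‖ = 1) :
    fderiv ℝ (fun y : En n => inner ℝ y e) z e = 1 := by
  rw [fderiv_inner_apply ℝ (by fun_prop) (by fun_prop)]
  simp [he]

lemma DirBound.integral_w_eq (hg : DirBound n e g v w) (c : ℝ) :
    ∫ z, w z ∂(gaussM n) = ∫ z, (v z - c) * inner ℝ z e ∂(gaussM n) := by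
  have h := gauss_stein e (f := fun _ => 1) (g := v) (by fun_prop) hg.dv (Tame.const 1) hg.tv
    (by simpa using Tame.const 0) (by simpa only [hg.hw] using hg.tw) c
  simpa [hg.hw] using h

lemma DirBound.abs_integral_w_le (he : ‖e‖ = 1) (hg : DirBound n e g v w) (c : ℝ) :
    |∫ z, w z ∂(gaussM n)| ≤ 2 * √(gaussK n * ∫ z, (g z - c) ^ 2 ∂(gaussM n)) := by
  have h := stein_bound he (f := fun z => inner ℝ z e) (f' := fun _ => 1) (B := 1) zero_le_one
    (differentiable_id.inner ℝ (differentiable_const e)) hg.dg hg.tg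
    (by simpa only [hg.hv] using hg.tv)
    (fun z => fderiv_inner_right e z he) continuous_const (fun z => ?_) (fun z => ?_) c
  · rw [hg.integral_w_eq 0]
    simpa [hg.hv, mul_comm] using h
  · rw [one_mul]
    simpa using (abs_inner_le_norm_of_unit he z).trans (by
      simpa using pow_le_weight z (j := 1) (k := 5) (by norm_num))
  · rw [abs_one, one_mul]; exact one_le_pow₀ (by linarith [norm_nonneg z])

/-- First-order estimate, without assumptions on the position of the center. -/
lemma first_order_bound (he : ‖e‖ = 1) (hr : 0 ≤ r) (hN : 1 ≤ N) (hg : DirBound n e g v w)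
    (hζ : CutoffBound n e N r ζ) (c : ℝ) :
    ζ 0 ^ 2 * (∫ z, v z ∂(gaussM n)) ^ 2
      - 28 * N ^ 2 * r ^ 2 * gaussK n * (gaussK n * ∫ z, (g z - c) ^ 2 ∂(gaussM n))
      ≤ ∫ z, ζ z ^ 2 * v z ^ 2 ∂(gaussM n) := by
  set V := ∫ z, (g z - c) ^ 2 ∂(gaussM n) with hV
  set m := ∫ z, v z ∂(gaussM n) with hm
  set K := gaussK n with hK
  have hK1 : 1 ≤ K := one_le_gaussK n
  have hV0 : 0 ≤ V := integral_nonneg fun z => sq_nonneg _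
  set S := √(K * V) with hS
  have hS0 : 0 ≤ S := Real.sqrt_nonneg _
  have hSS : S ^ 2 = K * V := Real.sq_sqrt (by positivity)
  have hmS : |m| ≤ 2 * S := hg.abs_integral_v_le he c
  have tζ := hζ.tame
  have td : Tame n (fun z => ζ z - ζ 0) := tζ.sub (Tame.const _)
  have h1 : |∫ z, (ζ z - ζ 0) ^ 2 * v z ∂(gaussM n)| ≤ 2 * (2 * N ^ 2 * r ^ 2) * S := by
    have h := stein_bound he (f := fun z => (ζ z - ζ 0) ^ 2)
      (f' := fun z => 2 * (ζ z - ζ 0) * fderiv ℝ ζ z e) (B := 2 * N ^ 2 * r ^ 2) (by positivity)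
      ((hζ.diff.sub_const _).pow 2) hg.dg hg.tg (by simpa only [hg.hv] using hg.tv) (fun z => ?_)
      ((continuous_const.mul td.1).mul hζ.continuous_der) (fun z => ?_) (fun z => ?_) c
    · simpa only [hg.hv] using h
    · rw [fderiv_fun_pow 2 ((hζ.diff z).sub_const _)]
      simp [fderiv_sub_const]
    · rw [abs_of_nonneg (sq_nonneg _), ← sq_abs]
      calc |ζ z - ζ 0| ^ 2 ≤ (N * r * ‖z‖) ^ 2 := by gcongr; exact hζ.lip z
        _ = N ^ 2 * r ^ 2 * ‖z‖ ^ 2 := by ring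
        _ ≤ N ^ 2 * r ^ 2 * (1 + ‖z‖) ^ 5 := by gcongr; exact pow_le_weight z (by norm_num)
        _ ≤ _ := by
          have : 0 ≤ N ^ 2 * r ^ 2 * (1 + ‖z‖) ^ 5 := by positivity
          linarith
    · rw [abs_mul, abs_mul, abs_two]
      calc 2 * |ζ z - ζ 0| * |fderiv ℝ ζ z e| ≤ 2 * (N * r * ‖z‖) * (N * r) := by
            gcongr
            · exact hζ.lip z
            · exact hζ.der z
        _ = 2 * N ^ 2 * r ^ 2 * ‖z‖ ^ 1 := by ring
        _ ≤ _ := by gcongr; exact pow_le_weight z (by norm_num)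
  have h2 := hζ.mean
  have h3 := hζ.integral_sq_sub_le
  have h4 := hζ.bdd 0
  have key : ∫ z, (2 * m * ζ 0 ^ 2 * v z - 2 * m * ((ζ z - ζ 0) ^ 2 * v z)
      - m ^ 2 * (ζ 0 ^ 2 - 2 * ζ 0 * (ζ z - ζ 0) + (ζ z - ζ 0) ^ 2)) ∂(gaussM n)
      ≤ ∫ z, ζ z ^ 2 * v z ^ 2 ∂(gaussM n) := by
    refine integral_mono ?_ (tζ.sq.mul hg.tv.sq).integrable fun z => ?_
    · exact (((Tame.const _).mul hg.tv).sub ((Tame.const _).mul (td.sq.mul hg.tv))).sub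
        ((Tame.const _).mul (((Tame.const _).sub ((Tame.const _).mul td)).add td.sq)) |>.integrable
    · simp only
      nlinarith [sq_nonneg (ζ z * v z - m * (2 * ζ 0 - ζ z))]
  have i1 := (((Tame.const (2 * m * ζ 0 ^ 2)).mul hg.tv)).integrable
  have i2 := ((Tame.const (2 * m)).mul (td.sq.mul hg.tv)).integrable
  have i3 := ((Tame.const (2 * ζ 0)).mul td)
  have i4 := (Tame.const (n := n) (ζ 0 ^ 2)).sub i3
  have i5 := ((Tame.const (m ^ 2)).mul (i4.add td.sq)).integrable
  have i12 : Integrable (fun z => 2 * m * ζ 0 ^ 2 * v z - 2 * m * ((ζ z - ζ 0) ^ 2 * v z))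
      (gaussM n) := i1.sub i2
  rw [integral_sub i12 i5, integral_sub i1 i2, integral_const_mul, integral_const_mul,
    integral_const_mul, integral_add i4.integrable td.sq.integrable,
    integral_sub (Tame.const _).integrable i3.integrable, integral_const_mul,
    integral_sub tζ.integrable (Tame.const _).integrable] at key
  simp only [integral_const, probReal_univ, one_smul] at key
  rw [← hm] at key
  set X := ∫ z, (ζ z - ζ 0) ^ 2 * v z ∂(gaussM n)
  set Y := ∫ z, ζ z ∂(gaussM n) - ζ 0
  set W := ∫ z, (ζ z - ζ 0) ^ 2 ∂(gaussM n)
  have hmm : m ^ 2 ≤ 4 * S ^ 2 := by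
    rw [← sq_abs]
    calc |m| ^ 2 ≤ (2 * S) ^ 2 := by gcongr
      _ = _ := by ring
  have b1 : |m * X| ≤ 8 * N ^ 2 * r ^ 2 * S ^ 2 := by
    rw [abs_mul]
    calc |m| * |X| ≤ (2 * S) * (2 * (2 * N ^ 2 * r ^ 2) * S) := by gcongr
      _ = _ := by ring
  have b2 : |m ^ 2 * (ζ 0 * Y)| ≤ 4 * S ^ 2 * (N * (N * r ^ 2 * K)) := by
    rw [abs_mul, abs_mul, abs_of_nonneg (sq_nonneg m)]
    gcongr
  have b3 : m ^ 2 * W ≤ 4 * S ^ 2 * (N ^ 2 * r ^ 2 * K) := by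
    gcongr
  have b4 : N ^ 2 * r ^ 2 * S ^ 2 ≤ N ^ 2 * r ^ 2 * S ^ 2 * K := le_mul_of_one_le_right (by positivity) hK1
  rw [← hSS]
  have c1 := (abs_le.1 b1).2
  have c2 := (abs_le.1 b2).1
  linarith
end heat

section heat
variable {n : ℕ} {e : En n} {N r : ℝ} {g v w ζ a : En n → ℝ}

/-- A cutoff at scale `r` which equals one near the center. -/
structure UnitCutoff (n : ℕ) (e : En n) (N r : ℝ) (ζ : En n → ℝ) : Prop
    extends CutoffBound n e N r ζ where
  one : ζ 0 = 1
  second : ∀ z, |1 - ζ z| ≤ N * r ^ 2 * ‖z‖ ^ 2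
  der_second : ∀ z, |fderiv ℝ ζ z e| ≤ N * r ^ 2 * ‖z‖

lemma DirBound.abs_integral_mul_centered_le (he : ‖e‖ = 1) (hg : DirBound n e g v w)
    {f f' : En n → ℝ} {B : ℝ} (hB : 0 ≤ B) (hf : Differentiable ℝ f)
    (hf' : ∀ z, fderiv ℝ f z e = f' z) (cf' : Continuous f')
    (b : ∀ z, |f z| ≤ B * (1 + ‖z‖) ^ 5) (b' : ∀ z, |f' z| ≤ B * (1 + ‖z‖) ^ 5) (c : ℝ) :
    |∫ z, (v z - ∫ z, v z ∂(gaussM n)) * f z ∂(gaussM n)| ≤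
      4 * B * gaussK n * √(gaussK n * ∫ z, (g z - c) ^ 2 ∂(gaussM n)) := by
  have h1 := stein_bound he hB hf hg.dg hg.tg (by simpa only [hg.hv] using hg.tv) hf' cf' b b' c
  have h2 := hg.abs_integral_v_le he c
  have h3 : |∫ z, f z ∂(gaussM n)| ≤ B * gaussK n := abs_integral_le_gaussK fun z =>
    (b z).trans (by gcongr <;> norm_num)
  have tf : Tame n f := Tame.of_bound hf.continuous b
  set m := ∫ z, v z ∂(gaussM n)
  set S := √(gaussK n * ∫ z, (g z - c) ^ 2 ∂(gaussM n))
  have hS : 0 ≤ S := Real.sqrt_nonneg _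
  have hK := one_le_gaussK n
  have e1 : ∫ z, (v z - m) * f z ∂(gaussM n)
      = ∫ z, f z * fderiv ℝ g z e ∂(gaussM n) - m * ∫ z, f z ∂(gaussM n) := by
    rw [← integral_const_mul, ← integral_sub]
    · congr 1; ext z; rw [hg.hv]; ring
    · simpa only [hg.hv] using (tf.mul hg.tv).integrable
    · exact tf.integrable.const_mul _
  rw [e1]
  calc _ ≤ |∫ z, f z * fderiv ℝ g z e ∂(gaussM n)| + |m| * |∫ z, f z ∂(gaussM n)| := by
        rw [← abs_mul]; exact abs_sub _ _
    _ ≤ 2 * B * S + (2 * S) * (B * gaussK n) := by gcongr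
    _ ≤ _ := by
      have : B * S ≤ B * S * gaussK n := le_mul_of_one_le_right (by positivity) hK
      linarith

/-- First-order estimate at a center where the cutoff is one, with the variance term. -/
lemma first_order_bound_unit (he : ‖e‖ = 1) (hN : 1 ≤ N) (hg : DirBound n e g v w)
    (hζ : UnitCutoff n e N r ζ) (c : ℝ) :
    ∫ z, (ζ z * (v z - ∫ z, v z ∂(gaussM n))) ^ 2 ∂(gaussM n) + (∫ z, v z ∂(gaussM n)) ^ 2
      - 24 * N ^ 2 * r ^ 2 * gaussK n * (gaussK n * ∫ z, (g z - c) ^ 2 ∂(gaussM n))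
      ≤ ∫ z, ζ z ^ 2 * v z ^ 2 ∂(gaussM n) := by
  set V := ∫ z, (g z - c) ^ 2 ∂(gaussM n) with hV
  set m := ∫ z, v z ∂(gaussM n) with hm
  set K := gaussK n with hK
  have hK1 : 1 ≤ K := one_le_gaussK n
  have hV0 : 0 ≤ V := integral_nonneg fun z => sq_nonneg _
  set S := √(K * V) with hS
  have hS0 : 0 ≤ S := Real.sqrt_nonneg _
  have hSS : S ^ 2 = K * V := Real.sq_sqrt (by positivity)
  have hmS : |m| ≤ 2 * S := hg.abs_integral_v_le he c
  have tζ := hζ.tame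
  have bf : ∀ z, |ζ z ^ 2 - 1| ≤ 2 * N ^ 2 * r ^ 2 * ‖z‖ ^ 2 := fun z => by
    have h1 := hζ.second z
    have h2 := hζ.bdd z
    have h3 : |ζ z + 1| ≤ 2 * N := (abs_add_le _ _).trans (by rw [abs_one]; linarith)
    calc |ζ z ^ 2 - 1| = |ζ z + 1| * |1 - ζ z| := by
          rw [abs_sub_comm 1, ← abs_mul]; ring_nf
      _ ≤ (2 * N) * (N * r ^ 2 * ‖z‖ ^ 2) := by gcongr
      _ = _ := by ring
  have tf : Tame n (fun z => ζ z ^ 2 - 1) := tζ.sq.sub (Tame.const 1)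
  have h1 : |∫ z, (ζ z ^ 2 - 1) * v z ∂(gaussM n)| ≤ 2 * (2 * N ^ 2 * r ^ 2) * S := by
    have h := stein_bound he (f := fun z => ζ z ^ 2 - 1)
      (f' := fun z => 2 * ζ z * fderiv ℝ ζ z e) (B := 2 * N ^ 2 * r ^ 2) (by positivity)
      ((hζ.diff.pow 2).sub_const _) hg.dg hg.tg (by simpa only [hg.hv] using hg.tv) (fun z => ?_)
      ((continuous_const.mul tζ.1).mul hζ.continuous_der) (fun z => ?_) (fun z => ?_) c
    · simpa only [hg.hv] using h
    · rw [fderiv_sub_const, fderiv_fun_pow 2 (hζ.diff z)]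
      simp
    · refine (bf z).trans ?_
      gcongr; exact pow_le_weight z (by norm_num)
    · rw [abs_mul, abs_mul, abs_two]
      calc 2 * |ζ z| * |fderiv ℝ ζ z e| ≤ 2 * N * (N * r ^ 2 * ‖z‖) := by
            gcongr
            · exact hζ.bdd z
            · exact hζ.der_second z
        _ = 2 * N ^ 2 * r ^ 2 * ‖z‖ ^ 1 := by ring
        _ ≤ _ := by gcongr; exact pow_le_weight z (by norm_num)
  have h2 : |∫ z, (ζ z ^ 2 - 1) ∂(gaussM n)| ≤ 2 * N ^ 2 * r ^ 2 * K :=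
    abs_integral_le_gaussK fun z => (bf z).trans (by gcongr; exact pow_le_weight z (by norm_num))
  have t0 := (tζ.mul (hg.tv.sub (Tame.const m))).sq
  have key : ∫ z, ζ z ^ 2 * v z ^ 2 ∂(gaussM n)
      = ∫ z, (ζ z * (v z - m)) ^ 2 ∂(gaussM n) + (2 * m * m
        + 2 * m * ∫ z, (ζ z ^ 2 - 1) * v z ∂(gaussM n) - m ^ 2
        - m ^ 2 * ∫ z, (ζ z ^ 2 - 1) ∂(gaussM n)) := by
    have e1 : ∫ z, ((ζ z * (v z - m)) ^ 2 + (2 * m * v z + 2 * m * ((ζ z ^ 2 - 1) * v z) - m ^ 2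
        - m ^ 2 * (ζ z ^ 2 - 1))) ∂(gaussM n) = ∫ z, ζ z ^ 2 * v z ^ 2 ∂(gaussM n) := by
      congr 1; ext z; ring
    have t1 := (Tame.const (2 * m)).mul hg.tv
    have t2 := (Tame.const (2 * m)).mul (tf.mul hg.tv)
    have t3 := (Tame.const (m ^ 2)).mul tf
    have t4 := (t1.add t2).sub (Tame.const (m ^ 2))
    rw [← e1, integral_add t0.integrable (t4.sub t3).integrable,
      integral_sub t4.integrable t3.integrable,
      integral_sub (t1.add t2).integrable (Tame.const _).integrable,
      integral_add t1.integrable t2.integrable, integral_const_mul, integral_const_mul,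
      integral_const_mul]
    simp [hm]
  rw [key]
  set X := ∫ z, (ζ z ^ 2 - 1) * v z ∂(gaussM n)
  set Y := ∫ z, (ζ z ^ 2 - 1) ∂(gaussM n)
  have hmm : m ^ 2 ≤ 4 * S ^ 2 := by
    rw [← sq_abs]
    calc |m| ^ 2 ≤ (2 * S) ^ 2 := by gcongr
      _ = _ := by ring
  have b1 : |m * X| ≤ 8 * N ^ 2 * r ^ 2 * S ^ 2 := by
    rw [abs_mul]
    calc |m| * |X| ≤ (2 * S) * (2 * (2 * N ^ 2 * r ^ 2) * S) := by gcongr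
      _ = _ := by ring
  have b2 : |m ^ 2 * Y| ≤ 4 * S ^ 2 * (2 * N ^ 2 * r ^ 2 * K) := by
    rw [abs_mul, abs_of_nonneg (sq_nonneg m)]
    gcongr
  have b4 : N ^ 2 * r ^ 2 * S ^ 2 ≤ N ^ 2 * r ^ 2 * S ^ 2 * K :=
    le_mul_of_one_le_right (by positivity) hK1
  rw [← hSS]
  have c1 := (abs_le.1 b1).1
  have c2 := (abs_le.1 b2).2
  linarith

lemma fderiv_tail (he : ‖e‖ = 1) (hζ : UnitCutoff n e N r ζ) (z : En n) :
    fderiv ℝ (fun z => (1 - ζ z) * inner ℝ z e) z e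
      = (1 - ζ z) - fderiv ℝ ζ z e * inner ℝ z e := by
  have hd : DifferentiableAt ℝ (fun z : En n => (inner ℝ z e : ℝ)) z :=
    (differentiable_id.inner ℝ (differentiable_const e)) z
  rw [fderiv_fun_mul ((hζ.diff z).const_sub 1) hd]
  simp only [add_apply, smul_apply, smul_eq_mul,
    fderiv_inner_right e z he]
  rw [fderiv_const_sub]
  simp
  ring

/-- The second-order mean is controlled by the variance of the first-order one. -/
lemma second_order_mean_bound (he : ‖e‖ = 1) (hr : 0 ≤ r) (hN : 1 ≤ N)
    (hg : DirBound n e g v w) (hζ : UnitCutoff n e N r ζ) (c : ℝ) :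
    |∫ z, w z ∂(gaussM n)| ≤
      √(gaussK n * ∫ z, (ζ z * (v z - ∫ z, v z ∂(gaussM n))) ^ 2 ∂(gaussM n))
      + 8 * N * r * gaussK n * √(gaussK n * ∫ z, (g z - c) ^ 2 ∂(gaussM n)) := by
  have h0 := hg.integral_w_eq (∫ z, v z ∂(gaussM n))
  have tζ := hζ.tame
  have ti := Tame.inner_right e
  have h2 := hg.abs_integral_mul_centered_le he (f := fun z => (1 - ζ z) * inner ℝ z e)
    (f' := fun z => (1 - ζ z) - fderiv ℝ ζ z e * inner ℝ z e) (B := 2 * N * r) (by positivity)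
    ((hζ.diff.const_sub 1).mul (differentiable_id.inner ℝ (differentiable_const e)))
    (fderiv_tail he hζ)
    (((continuous_const.sub tζ.1)).sub (hζ.continuous_der.mul ti.1)) (fun z => ?_) (fun z => ?_) c
  · set m := ∫ z, v z ∂(gaussM n)
    have tvm := hg.tv.sub (Tame.const m)
    have h1 := abs_integral_mul_le (f := fun z => inner ℝ z e) (g := fun z => ζ z * (v z - m))
      (B := 1) zero_le_one ti (tζ.mul tvm) fun z => by
        rw [one_mul]
        exact (abs_inner_le_norm_of_unit he z).trans (by
          simpa using pow_le_weight z (j := 1) (k := 6) (by norm_num))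
    have e1 : ∫ z, (v z - m) * inner ℝ z e ∂(gaussM n)
        = ∫ z, ζ z * (v z - m) * inner ℝ z e ∂(gaussM n)
          + ∫ z, (v z - m) * ((1 - ζ z) * inner ℝ z e) ∂(gaussM n) := by
      rw [← integral_add ((tζ.mul tvm).mul ti).integrable
        (tvm.mul (((Tame.const 1).sub tζ).mul ti)).integrable]
      congr 1; ext z; ring
    rw [h0, e1]
    refine (abs_add_le _ _).trans ((add_le_add h1 h2).trans (le_of_eq ?_))
    ring
  · have h := hζ.lip z
    rw [hζ.one] at h
    rw [abs_mul, abs_sub_comm]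
    calc |ζ z - 1| * |inner ℝ z e| ≤ (N * r * ‖z‖) * ‖z‖ := by
          gcongr
          exact abs_inner_le_norm_of_unit he z
      _ = N * r * ‖z‖ ^ 2 := by ring
      _ ≤ N * r * (1 + ‖z‖) ^ 5 := by gcongr; exact pow_le_weight z (by norm_num)
      _ ≤ _ := by
        have : 0 ≤ N * r * (1 + ‖z‖) ^ 5 := by positivity
        linarith
  · have h := hζ.lip z
    rw [hζ.one] at h
    refine (abs_sub _ _).trans ?_
    rw [abs_mul, abs_sub_comm]
    calc |ζ z - 1| + |fderiv ℝ ζ z e| * |inner ℝ z e| ≤ N * r * ‖z‖ + (N * r) * ‖z‖ := by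
          gcongr
          · exact hζ.der z
          · exact abs_inner_le_norm_of_unit he z
      _ = 2 * N * r * ‖z‖ ^ 1 := by ring
      _ ≤ _ := by gcongr; exact pow_le_weight z (by norm_num)

end heat

/-- The scaled multiplier `b² (p (t / b) - 1)` with `p s = 4 s² / (1 + s²)²`. -/
def multQ (b t : ℝ) : ℝ := 4 * t ^ 2 * b ^ 4 / (b ^ 2 + t ^ 2) ^ 2 - b ^ 2

/-- The derivative of `multQ b`. -/
def multQ' (b t : ℝ) : ℝ := 8 * b ^ 4 * t * (b ^ 2 - t ^ 2) / (b ^ 2 + t ^ 2) ^ 3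

lemma multQ_den_pos {b : ℝ} (hb : b ≠ 0) (t : ℝ) : 0 < b ^ 2 + t ^ 2 := by positivity

lemma hasDerivAt_multQ {b : ℝ} (hb : b ≠ 0) (t : ℝ) : HasDerivAt (multQ b) (multQ' b t) t := by
  have h0 := (multQ_den_pos hb t).ne'
  have h1 : HasDerivAt (fun t : ℝ => 4 * t ^ 2 * b ^ 4) (4 * (2 * t) * b ^ 4) t := by
    have := ((hasDerivAt_pow 2 t).const_mul 4).mul_const (b ^ 4)
    simpa using this
  have h2 : HasDerivAt (fun t : ℝ => (b ^ 2 + t ^ 2) ^ 2) (2 * (b ^ 2 + t ^ 2) * (2 * t)) t := by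
    have := ((hasDerivAt_pow 2 t).const_add (b ^ 2)).fun_pow 2
    simpa using this
  have h3 := (h1.div h2 (by positivity)).sub_const (b ^ 2)
  refine h3.congr_deriv ?_
  unfold multQ'
  field_simp
  ring

lemma abs_multQ_le {b : ℝ} (hb : b ≠ 0) (t : ℝ) : |multQ b t| ≤ 2 * (t - b) ^ 2 := by
  have h0 := multQ_den_pos hb t
  have e : multQ b t = -(b ^ 2 * (t - b) ^ 2 * (t + b) ^ 2 / (b ^ 2 + t ^ 2) ^ 2) := by
    unfold multQ; field_simp; ring
  rw [e, abs_neg, abs_of_nonneg (by positivity), div_le_iff₀ (by positivity)]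
  have h1 : b ^ 2 * (t + b) ^ 2 ≤ 2 * (b ^ 2 + t ^ 2) ^ 2 := by
    nlinarith [mul_nonneg (sq_nonneg b) (sq_nonneg (t - b)), mul_nonneg (sq_nonneg b) (sq_nonneg t),
      sq_nonneg (t ^ 2)]
  nlinarith [mul_le_mul_of_nonneg_left h1 (sq_nonneg (t - b))]

lemma abs_multQ'_le {b : ℝ} (hb : b ≠ 0) (t : ℝ) : |multQ' b t| ≤ 12 * |t - b| := by
  have h0 := multQ_den_pos hb t
  have e : multQ' b t = -((8 * b ^ 4 * (t * (b + t)) / (b ^ 2 + t ^ 2) ^ 3) * (t - b)) := by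
    unfold multQ'; field_simp; ring
  rw [e, abs_neg, abs_mul]
  gcongr
  rw [abs_div, abs_of_pos (show 0 < (b ^ 2 + t ^ 2) ^ 3 by positivity),
    div_le_iff₀ (by positivity), abs_mul, abs_of_nonneg (by positivity : 0 ≤ 8 * b ^ 4)]
  have h1 : |t * (b + t)| ≤ 3 / 2 * (b ^ 2 + t ^ 2) := by
    rw [abs_le]; constructor <;> nlinarith [sq_nonneg (b - t), sq_nonneg (b + t)]
  have h2 : b ^ 4 ≤ (b ^ 2 + t ^ 2) ^ 2 := by
    nlinarith [mul_nonneg (sq_nonneg b) (sq_nonneg t), sq_nonneg (t ^ 2)]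
  calc 8 * b ^ 4 * |t * (b + t)| ≤ 8 * (b ^ 2 + t ^ 2) ^ 2 * (3 / 2 * (b ^ 2 + t ^ 2)) := by
        gcongr
    _ = _ := by ring

lemma continuous_multQ {b : ℝ} (hb : b ≠ 0) : Continuous (multQ b) :=
  continuous_iff_continuousAt.2 fun t => (hasDerivAt_multQ hb t).continuousAt

lemma continuous_multQ' {b : ℝ} (hb : b ≠ 0) : Continuous (multQ' b) := by
  unfold multQ'
  exact Continuous.div (by fun_prop) (by fun_prop) fun t =>
    ne_of_gt (pow_pos (multQ_den_pos hb t) 3)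

/-- Linearization of the positive part squared, optimized in the cutoff. -/
lemma sq_mul_pos_part_ge {b : ℝ} (hb : b ≠ 0) (t : ℝ) {M : ℝ} (hM : 0 ≤ M) (y : ℝ) :
    2 * M * ((b ^ 2 + multQ b t) * y)
      - M ^ 2 * (b ^ 2 - 2 * b * (t - b) + 3 * (t - b) ^ 2) ≤ t ^ 2 * (max y 0) ^ 2 := by
  have h0 := multQ_den_pos hb t
  set D := b ^ 2 + t ^ 2 with hD
  set μ := 4 * b ^ 4 / D ^ 2 with hμ
  have hμ0 : 0 ≤ μ := by positivity
  have e1 : b ^ 2 + multQ b t = t ^ 2 * μ := by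
    simp only [multQ, hμ, ← hD]; ring
  have h1 : 2 * (M * μ) * y - (M * μ) ^ 2 ≤ (max y 0) ^ 2 := by
    have : y ≤ max y 0 := le_max_left _ _
    nlinarith [sq_nonneg (max y 0 - M * μ), mul_nonneg hM hμ0]
  have h2 : t ^ 2 * μ ^ 2 ≤ b ^ 2 - 2 * b * (t - b) + 3 * (t - b) ^ 2 := by
    have hμD : μ * D ^ 2 = 4 * b ^ 4 := by rw [hμ]; field_simp
    have h4 : t ^ 2 * μ ^ 2 * D ^ 2 ≤ 4 * b ^ 6 := by
      have h5 : 4 * t ^ 2 * b ^ 2 ≤ D ^ 2 := by rw [hD]; nlinarith [sq_nonneg (b ^ 2 - t ^ 2)]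
      have h6 : t ^ 2 * μ ^ 2 * D ^ 2 = (4 * t ^ 2 * b ^ 2) * (μ * b ^ 2) := by
        calc t ^ 2 * μ ^ 2 * D ^ 2 = t ^ 2 * μ * (μ * D ^ 2) := by ring
          _ = _ := by rw [hμD]; ring
      rw [h6]
      calc (4 * t ^ 2 * b ^ 2) * (μ * b ^ 2) ≤ D ^ 2 * (μ * b ^ 2) := by gcongr
        _ = (μ * D ^ 2) * b ^ 2 := by ring
        _ = _ := by rw [hμD]; ring
    have h5 : 4 * b ^ 6 ≤ (b ^ 2 - 2 * b * (t - b) + 3 * (t - b) ^ 2) * D ^ 2 := by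
      have : (b ^ 2 - 2 * b * (t - b) + 3 * (t - b) ^ 2) * D ^ 2 - 4 * b ^ 6
        = (t - b) ^ 2 * (3 * t ^ 4 - 2 * b * t ^ 3 + 5 * b ^ 2 * t ^ 2 - 4 * b ^ 3 * t
          + 2 * b ^ 4) := by rw [hD]; ring
      have h7 : 0 ≤ 3 * t ^ 4 - 2 * b * t ^ 3 + 5 * b ^ 2 * t ^ 2 - 4 * b ^ 3 * t
          + 2 * b ^ 4 := by
        have : 3 * t ^ 4 - 2 * b * t ^ 3 + 5 * b ^ 2 * t ^ 2 - 4 * b ^ 3 * t + 2 * b ^ 4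
          = 2 * t ^ 4 + t ^ 2 * (t - b) ^ 2 + 2 * b ^ 2 * (t - b) ^ 2 + 2 * (b * t) ^ 2 := by ring
        rw [this]; positivity
      nlinarith [mul_nonneg (sq_nonneg (t - b)) h7]
    exact le_of_mul_le_mul_right (h4.trans h5) (by positivity)
  rw [e1]
  nlinarith [mul_le_mul_of_nonneg_left h1 (sq_nonneg t), mul_le_mul_of_nonneg_left h2 (sq_nonneg M)]

section heat
variable {n : ℕ} {e : En n} {N r : ℝ} {g v w ζ a : En n → ℝ}

/-- The multiplier term is small: it only sees the region where the first-order cutoff is one,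
up to a higher order remainder. -/
lemma abs_integral_multQ_le (he : ‖e‖ = 1) (hr : 0 ≤ r) (hN : 1 ≤ N) (hg : DirBound n e g v w)
    (hζ : UnitCutoff n e N r ζ) (ha : CutoffBound n e N r a) (ha0 : a 0 ≠ 0)
    (hs : ∀ z, (a z ≠ 0 ∨ fderiv ℝ a z e ≠ 0) → ζ z = 1 ∧ fderiv ℝ ζ z e = 0) (c : ℝ) :
    |∫ z, multQ (a 0) (a z) * w z ∂(gaussM n)| ≤
      14 * N ^ 2 * r ^ 2 *
        √(gaussK n * ∫ z, (ζ z * (v z - ∫ z, v z ∂(gaussM n))) ^ 2 ∂(gaussM n))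
      + 8 * N ^ 3 * r ^ 4 * gaussK n * √(gaussK n * ∫ z, (g z - c) ^ 2 ∂(gaussM n)) := by
  set b := a 0 with hb
  have tζ := hζ.tame
  have ta := ha.tame
  have ti := Tame.inner_right e
  have tail : ∀ z, a z = 0 → b ^ 2 ≤ N ^ 2 * r ^ 2 * ‖z‖ ^ 2 := fun z hz => by
    have h := ha.lip z
    rw [hz, zero_sub, abs_neg] at h
    rw [← sq_abs]
    calc |b| ^ 2 ≤ (N * r * ‖z‖) ^ 2 := by gcongr
      _ = _ := by ring
  have hQd : ∀ z, HasFDerivAt (fun z => multQ b (a z)) (multQ' b (a z) • fderiv ℝ a z) z :=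
    fun z => (hasDerivAt_multQ ha0 (a z)).comp_hasFDerivAt z (ha.diff z).hasFDerivAt
  have hQe : ∀ z, fderiv ℝ (fun z => multQ b (a z)) z e = multQ' b (a z) * fderiv ℝ a z e :=
    fun z => by rw [(hQd z).fderiv]; simp
  have bQ : ∀ z, |multQ b (a z)| ≤ 2 * N ^ 2 * r ^ 2 * ‖z‖ ^ 2 := fun z => by
    refine (abs_multQ_le ha0 (a z)).trans ?_
    rw [← sq_abs]
    calc 2 * |a z - b| ^ 2 ≤ 2 * (N * r * ‖z‖) ^ 2 := by gcongr; exact ha.lip z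
      _ = _ := by ring
  have bQ' : ∀ z, |multQ' b (a z) * fderiv ℝ a z e| ≤ 12 * N ^ 2 * r ^ 2 * ‖z‖ := fun z => by
    rw [abs_mul]
    calc |multQ' b (a z)| * |fderiv ℝ a z e| ≤ (12 * (N * r * ‖z‖)) * (N * r) := by
          gcongr
          · exact (abs_multQ'_le ha0 (a z)).trans (by gcongr; exact ha.lip z)
          · exact ha.der z
      _ = _ := by ring
  have tQ : Tame n (fun z => multQ b (a z)) :=
    Tame.of_bound ((continuous_multQ ha0).comp ta.1) (C := 2 * N ^ 2 * r ^ 2) (k := 2) fun z =>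
      (bQ z).trans (by gcongr; linarith [norm_nonneg z])
  have tQ' : Tame n (fun z => multQ' b (a z) * fderiv ℝ a z e) :=
    Tame.of_bound (((continuous_multQ' ha0).comp ta.1).mul ha.continuous_der)
      (C := 12 * N ^ 2 * r ^ 2) (k := 1) fun z =>
      (bQ' z).trans (by gcongr; simp)
  have h2 := hg.abs_integral_mul_centered_le he
    (f := fun z => b ^ 2 * ((1 - ζ z) * inner ℝ z e))
    (f' := fun z => b ^ 2 * ((1 - ζ z) - fderiv ℝ ζ z e * inner ℝ z e)) (B := 2 * N ^ 3 * r ^ 4)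
    (by positivity)
    (((hζ.diff.const_sub 1).mul (differentiable_id.inner ℝ (differentiable_const e))).const_mul _)
    (fun z => ?_)
    (continuous_const.mul (((continuous_const.sub tζ.1)).sub (hζ.continuous_der.mul ti.1)))
    (fun z => ?_) (fun z => ?_) c
  · have st := gauss_stein e (f := fun z => multQ b (a z)) (g := v)
      (fun z => (hQd z).differentiableAt) hg.dv tQ hg.tv (by simpa only [hQe] using tQ')
      (by simpa only [hg.hw] using hg.tw) (∫ z, v z ∂(gaussM n))
    simp only [hg.hw, hQe] at st
    set m := ∫ z, v z ∂(gaussM n)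
    have tvm := hg.tv.sub (Tame.const m)
    have tD := (tQ.mul ti).sub tQ'
    have h1 := abs_integral_mul_le
      (f := fun z => multQ b (a z) * inner ℝ z e - multQ' b (a z) * fderiv ℝ a z e)
      (g := fun z => ζ z * (v z - m)) (B := 14 * N ^ 2 * r ^ 2) (by positivity) tD
      (tζ.mul tvm) fun z => by
        refine (abs_sub _ _).trans ?_
        rw [abs_mul]
        have h3 := pow_le_weight z (j := 3) (k := 6) (by norm_num)
        have h4 := pow_le_weight z (j := 1) (k := 6) (by norm_num)
        calc |multQ b (a z)| * |inner ℝ z e| + |multQ' b (a z) * fderiv ℝ a z e|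
            ≤ (2 * N ^ 2 * r ^ 2 * ‖z‖ ^ 2) * ‖z‖ + 12 * N ^ 2 * r ^ 2 * ‖z‖ := by
              gcongr
              · exact bQ z
              · exact abs_inner_le_norm_of_unit he z
              · exact bQ' z
          _ = 2 * N ^ 2 * r ^ 2 * ‖z‖ ^ 3 + 12 * N ^ 2 * r ^ 2 * ‖z‖ ^ 1 := by ring
          _ ≤ 2 * N ^ 2 * r ^ 2 * (1 + ‖z‖) ^ 6 + 12 * N ^ 2 * r ^ 2 * (1 + ‖z‖) ^ 6 := by
              gcongr
          _ = _ := by ring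
    have e1 : ∫ z, (v z - m) * (multQ b (a z) * inner ℝ z e - multQ' b (a z) * fderiv ℝ a z e)
        ∂(gaussM n)
        = ∫ z, ζ z * (v z - m) *
            (multQ b (a z) * inner ℝ z e - multQ' b (a z) * fderiv ℝ a z e) ∂(gaussM n)
          - ∫ z, (v z - m) * (b ^ 2 * ((1 - ζ z) * inner ℝ z e)) ∂(gaussM n) := by
      rw [← integral_sub ((tζ.mul tvm).mul tD).integrable
        (tvm.mul ((Tame.const _).mul (((Tame.const 1).sub tζ).mul ti))).integrable]
      congr 1; ext z
      by_cases hz : a z ≠ 0 ∨ fderiv ℝ a z e ≠ 0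
      · rw [(hs z hz).1]; ring
      · push Not at hz
        rw [hz.1, hz.2]
        have : multQ b 0 = -b ^ 2 := by simp [multQ]
        rw [this]; ring
    rw [st, e1]
    refine (abs_sub _ _).trans ((add_le_add h1 h2).trans (le_of_eq ?_))
    ring
  · have hd : DifferentiableAt ℝ (fun z : En n => (1 - ζ z) * inner ℝ z e) z :=
      ((hζ.diff.const_sub 1).mul (differentiable_id.inner ℝ (differentiable_const e))) z
    rw [fderiv_const_mul hd]
    simp only [smul_apply, smul_eq_mul]
    exact congrArg _ (fderiv_tail he hζ z)
  · by_cases hz : a z = 0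
    · have h3 := pow_le_weight z (j := 5) (k := 5) le_rfl
      rw [abs_mul, abs_mul, abs_of_nonneg (sq_nonneg b)]
      calc b ^ 2 * (|1 - ζ z| * |inner ℝ z e|)
          ≤ (N ^ 2 * r ^ 2 * ‖z‖ ^ 2) * ((N * r ^ 2 * ‖z‖ ^ 2) * ‖z‖) := by
            gcongr
            · exact tail z hz
            · exact hζ.second z
            · exact abs_inner_le_norm_of_unit he z
        _ = N ^ 3 * r ^ 4 * ‖z‖ ^ 5 := by ring
        _ ≤ N ^ 3 * r ^ 4 * (1 + ‖z‖) ^ 5 := by gcongr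
        _ ≤ _ := by
          have : 0 ≤ N ^ 3 * r ^ 4 * (1 + ‖z‖) ^ 5 := by positivity
          linarith
    · rw [(hs z (Or.inl hz)).1]
      simp only [sub_self, zero_mul, mul_zero, abs_zero]
      positivity
  · by_cases hz : a z = 0
    · have h3 := pow_le_weight z (j := 4) (k := 5) (by norm_num)
      rw [abs_mul, abs_of_nonneg (sq_nonneg b)]
      calc b ^ 2 * |(1 - ζ z) - fderiv ℝ ζ z e * inner ℝ z e|
          ≤ (N ^ 2 * r ^ 2 * ‖z‖ ^ 2) * ((N * r ^ 2 * ‖z‖ ^ 2) + (N * r ^ 2 * ‖z‖) * ‖z‖) := by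
            gcongr
            · exact tail z hz
            · refine (abs_sub _ _).trans ?_
              rw [abs_mul]
              gcongr
              · exact hζ.second z
              · exact hζ.der_second z
              · exact abs_inner_le_norm_of_unit he z
        _ = 2 * N ^ 3 * r ^ 4 * ‖z‖ ^ 4 := by ring
        _ ≤ 2 * N ^ 3 * r ^ 4 * (1 + ‖z‖) ^ 5 := by gcongr
    · have h4 := hs z (Or.inl hz)
      rw [h4.1, h4.2]
      simp only [sub_self, zero_mul, mul_zero, abs_zero]
      positivity

/-- Second-order estimate at a center where the second-order cutoff does not vanish. -/
lemma second_order_bound (he : ‖e‖ = 1) (hr : 0 ≤ r) (hN : 1 ≤ N) (hg : DirBound n e g v w)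
    (hζ : UnitCutoff n e N r ζ) (ha : CutoffBound n e N r a) (ha0 : a 0 ≠ 0)
    (hs : ∀ z, (a z ≠ 0 ∨ fderiv ℝ a z e ≠ 0) → ζ z = 1 ∧ fderiv ℝ ζ z e = 0)
    (hw : 0 ≤ ∫ z, w z ∂(gaussM n)) (c : ℝ) :
    a 0 ^ 2 * (∫ z, w z ∂(gaussM n)) ^ 2
      - 52 * N ^ 2 * r ^ 2 * gaussK n ^ 2 *
        ∫ z, (ζ z * (v z - ∫ z, v z ∂(gaussM n))) ^ 2 ∂(gaussM n)
      - 2464 * N ^ 4 * r ^ 4 * gaussK n ^ 3 * (gaussK n * ∫ z, (g z - c) ^ 2 ∂(gaussM n))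
      ≤ ∫ z, a z ^ 2 * (max (w z) 0) ^ 2 ∂(gaussM n) := by
  have h1 := abs_integral_multQ_le he hr hN hg hζ ha ha0 hs c
  have h2 := second_order_mean_bound he hr hN hg hζ c
  have h3 := hg.abs_integral_w_le he c
  have h4 := ha.mean
  have h5 := ha.integral_sq_sub_le
  have h6 := ha.bdd 0
  have ta := ha.tame
  have td : Tame n (fun z => a z - a 0) := ta.sub (Tame.const _)
  have tQ : Tame n (fun z => multQ (a 0) (a z)) := by
    refine Tame.of_bound ((continuous_multQ ha0).comp ta.1) (C := 2 * N ^ 2 * r ^ 2) (k := 2)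
      fun z => (abs_multQ_le ha0 (a z)).trans ?_
    rw [← sq_abs]
    calc 2 * |a z - a 0| ^ 2 ≤ 2 * (N * r * ‖z‖) ^ 2 := by gcongr; exact ha.lip z
      _ = 2 * N ^ 2 * r ^ 2 * ‖z‖ ^ 2 := by ring
      _ ≤ _ := by gcongr; linarith [norm_nonneg z]
  set V := ∫ z, (g z - c) ^ 2 ∂(gaussM n) with hV
  set A := ∫ z, (ζ z * (v z - ∫ z, v z ∂(gaussM n))) ^ 2 ∂(gaussM n)
  set M := ∫ z, w z ∂(gaussM n) with hM
  set K := gaussK n with hK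
  set b := a 0
  have hK1 : 1 ≤ K := one_le_gaussK n
  have hV0 : 0 ≤ V := integral_nonneg fun z => sq_nonneg _
  have hA0 : 0 ≤ A := integral_nonneg fun z => sq_nonneg _
  set S := √(K * V) with hS
  have hS0 : 0 ≤ S := Real.sqrt_nonneg _
  have hSS : S ^ 2 = K * V := Real.sq_sqrt (by positivity)
  set P := √(K * A)
  have hP0 : 0 ≤ P := Real.sqrt_nonneg _
  have hPP : P ^ 2 = K * A := Real.sq_sqrt (by positivity)
  set X := ∫ z, multQ b (a z) * w z ∂(gaussM n)
  set W := ∫ z, (a z - b) ^ 2 ∂(gaussM n)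
  have key : 2 * M * (b ^ 2 * M + X) - M ^ 2 * (b ^ 2 - 2 * b * (∫ z, a z ∂(gaussM n) - b) + 3 * W)
      ≤ ∫ z, a z ^ 2 * (max (w z) 0) ^ 2 ∂(gaussM n) := by
    have t1 := (Tame.const (2 * M)).mul (((Tame.const (b ^ 2)).mul hg.tw).add (tQ.mul hg.tw))
    have t2 := (Tame.const (2 * b)).mul td
    have t3 := (Tame.const 3).mul td.sq
    have t4 := (Tame.const (M ^ 2)).mul (((Tame.const (b ^ 2)).sub t2).add t3)
    have h := integral_mono (t1.sub t4).integrable (ta.sq.mul hg.tw.pos_part.sq).integrable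
      fun z => by
        have := sq_mul_pos_part_ge ha0 (a z) hw (w z)
        rw [add_mul] at this
        exact this
    rw [integral_sub t1.integrable t4.integrable, integral_const_mul, integral_const_mul,
      integral_add ((Tame.const (b ^ 2)).mul hg.tw).integrable (tQ.mul hg.tw).integrable,
      integral_add ((Tame.const (b ^ 2)).sub t2).integrable t3.integrable,
      integral_sub (Tame.const (b ^ 2)).integrable t2.integrable, integral_const_mul,
      integral_const_mul, integral_const_mul,
      integral_sub ta.integrable (Tame.const b).integrable] at h
    simpa only [integral_const, probReal_univ, one_smul] using h
  set Y := ∫ z, a z ∂(gaussM n) - b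
  rw [abs_of_nonneg hw] at h2 h3
  have b1 : |M * X| ≤ 14 * N ^ 2 * r ^ 2 * P * (P + 8 * N * r * K * S)
      + 16 * N ^ 3 * r ^ 4 * K * S ^ 2 := by
    rw [abs_mul, abs_of_nonneg hw]
    calc M * |X| ≤ M * (14 * N ^ 2 * r ^ 2 * P + 8 * N ^ 3 * r ^ 4 * K * S) := by gcongr
      _ = 14 * N ^ 2 * r ^ 2 * P * M + 8 * N ^ 3 * r ^ 4 * K * S * M := by ring
      _ ≤ 14 * N ^ 2 * r ^ 2 * P * (P + 8 * N * r * K * S)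
          + 8 * N ^ 3 * r ^ 4 * K * S * (2 * S) := by gcongr
      _ = _ := by ring
  have hMM : M ^ 2 ≤ 2 * P ^ 2 + 128 * N ^ 2 * r ^ 2 * K ^ 2 * S ^ 2 := by
    calc M ^ 2 ≤ (P + 8 * N * r * K * S) ^ 2 := by gcongr
      _ ≤ _ := by nlinarith [sq_nonneg (P - 8 * N * r * K * S)]
  have b2 : |b * Y| ≤ N * (N * r ^ 2 * K) := by rw [abs_mul]; gcongr
  have b3 : M ^ 2 * (2 * |b * Y| + 3 * W) ≤ (2 * P ^ 2 + 128 * N ^ 2 * r ^ 2 * K ^ 2 * S ^ 2)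
      * (5 * N ^ 2 * r ^ 2 * K) := by
    have : 2 * |b * Y| + 3 * W ≤ 5 * N ^ 2 * r ^ 2 * K := by linarith
    have hW : 0 ≤ W := integral_nonneg fun z => sq_nonneg _
    gcongr
  have b4 : M ^ 2 * (-(2 * b * Y)) ≤ M ^ 2 * (2 * |b * Y|) := by
    gcongr
    linarith [neg_abs_le (b * Y)]
  have b5 : 224 * N ^ 3 * r ^ 3 * K * P * S
      ≤ N ^ 2 * r ^ 2 * (14 * P ^ 2 + 896 * N ^ 2 * r ^ 2 * K ^ 2 * S ^ 2) := by
    have : 0 ≤ N ^ 2 * r ^ 2 * (14 * (P - 8 * N * r * K * S) ^ 2) := by positivity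
    nlinarith
  have q1 : N ^ 2 * r ^ 2 * P ^ 2 ≤ N ^ 2 * r ^ 2 * P ^ 2 * K :=
    le_mul_of_one_le_right (by positivity) hK1
  have q2 : N ^ 4 * r ^ 4 * S ^ 2 * K ^ 2 ≤ N ^ 4 * r ^ 4 * S ^ 2 * K ^ 3 := by
    gcongr
    norm_num
  have q3 : N ^ 3 * r ^ 4 * K * S ^ 2 ≤ N ^ 4 * r ^ 4 * S ^ 2 * K ^ 3 := by
    calc N ^ 3 * r ^ 4 * K * S ^ 2 = N ^ 3 * r ^ 4 * K ^ 1 * S ^ 2 := by ring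
      _ ≤ N ^ 4 * r ^ 4 * K ^ 3 * S ^ 2 := by gcongr <;> norm_num
      _ = _ := by ring
  have q4 : K ^ 2 * A = K * P ^ 2 := by rw [hPP]; ring
  have b6 := (abs_le.1 b1).1
  have q0 : 0 ≤ N ^ 4 * r ^ 4 * S ^ 2 * K ^ 3 := by positivity
  have goal' : b ^ 2 * M ^ 2 - 52 * N ^ 2 * r ^ 2 * (K * P ^ 2) - 2464 * N ^ 4 * r ^ 4 * K ^ 3 * S ^ 2
      ≤ 2 * M * (b ^ 2 * M + X) - M ^ 2 * (b ^ 2 - 2 * b * Y + 3 * W) := by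
    linarith
  rw [← hSS]
  calc _ = b ^ 2 * M ^ 2 - 52 * N ^ 2 * r ^ 2 * (K * P ^ 2)
      - 2464 * N ^ 4 * r ^ 4 * K ^ 3 * S ^ 2 := by rw [← q4]; ring
    _ ≤ _ := goal'.trans key

/-- The key inequality for the heat semigroup. -/
lemma heat_inequality (he : ‖e‖ = 1) (hr : 0 ≤ r) (hN : 1 ≤ N) (hg : DirBound n e g v w)
    (hζ : CutoffBound n e N r ζ) (ha : CutoffBound n e N r a)
    (hu : a 0 ≠ 0 → UnitCutoff n e N r ζ)
    (hs : ∀ z, (a z ≠ 0 ∨ fderiv ℝ a z e ≠ 0) → ζ z = 1 ∧ fderiv ℝ ζ z e = 0)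
    {τ σ κ : ℝ} (hτ : 52 * gaussK n ^ 2 * N ^ 2 ≤ τ) (hσ : 2500 * gaussK n ^ 4 * N ^ 4 * τ ≤ σ) :
    a 0 ^ 2 * (max (∫ z, w z ∂(gaussM n)) 0) ^ 2
      + τ * r ^ 2 * (ζ 0 ^ 2 * (∫ z, v z ∂(gaussM n)) ^ 2)
      + σ * r ^ 4 * (∫ z, (g z - κ) ∂(gaussM n)) ^ 2
      ≤ ∫ z, (a z ^ 2 * (max (w z) 0) ^ 2 + τ * r ^ 2 * (ζ z ^ 2 * v z ^ 2)
          + σ * r ^ 4 * (g z - κ) ^ 2) ∂(gaussM n) := by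
  have t1 := ha.tame.sq.mul hg.tw.pos_part.sq
  have t2 := (Tame.const (τ * r ^ 2)).mul (hζ.tame.sq.mul hg.tv.sq)
  have tgk := hg.tg.sub (Tame.const κ)
  have t3 := (Tame.const (σ * r ^ 4)).mul tgk.sq
  rw [integral_add (t1.add t2).integrable t3.integrable, integral_add t1.integrable t2.integrable,
    integral_const_mul, integral_const_mul]
  set c := ∫ z, g z ∂(gaussM n) with hc
  have hvar : ∫ z, (g z - κ) ^ 2 ∂(gaussM n)
      = ∫ z, (g z - c) ^ 2 ∂(gaussM n) + (∫ z, (g z - κ) ∂(gaussM n)) ^ 2 := by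
    have tgc := hg.tg.sub (Tame.const c)
    have e1 : ∫ z, (g z - κ) ^ 2 ∂(gaussM n)
        = ∫ z, ((g z - c) ^ 2 + (2 * (c - κ) * (g z - c) + (c - κ) ^ 2)) ∂(gaussM n) := by
      congr 1; ext z; ring
    rw [e1, integral_add tgc.sq.integrable
      (((Tame.const _).mul tgc).add (Tame.const _)).integrable,
      integral_add ((Tame.const _).mul tgc).integrable (Tame.const _).integrable,
      integral_const_mul, integral_sub hg.tg.integrable (Tame.const _).integrable,
      integral_sub hg.tg.integrable (Tame.const _).integrable]
    simp [← hc]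
  rw [hvar]
  have h1 := first_order_bound he hr hN hg hζ c
  have hK1 := one_le_gaussK n
  have hV0 : 0 ≤ ∫ z, (g z - c) ^ 2 ∂(gaussM n) := integral_nonneg fun z => sq_nonneg _
  have hF0 : 0 ≤ ∫ z, a z ^ 2 * (max (w z) 0) ^ 2 ∂(gaussM n) :=
    integral_nonneg fun z => by positivity
  have hτ1 : 1 ≤ τ := by
    refine le_trans ?_ hτ
    have : 1 ≤ gaussK n ^ 2 * N ^ 2 := one_le_mul_of_one_le_of_one_le (one_le_pow₀ hK1)
      (one_le_pow₀ hN)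
    linarith
  by_cases hcase : a 0 ≠ 0 ∧ 0 ≤ ∫ z, w z ∂(gaussM n)
  · have h2 := first_order_bound_unit he hN hg (hu hcase.1) c
    have h3 := second_order_bound he hr hN hg (hu hcase.1) ha hcase.1 hs hcase.2 c
    rw [max_eq_left hcase.2, (hu hcase.1).one]
    have hA0 : 0 ≤ ∫ z, (ζ z * (v z - ∫ z, v z ∂(gaussM n))) ^ 2 ∂(gaussM n) :=
      integral_nonneg fun z => sq_nonneg _
    generalize (∫ z, (ζ z * (v z - ∫ z, v z ∂(gaussM n))) ^ 2 ∂(gaussM n)) = A at *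
    generalize (∫ z, (g z - c) ^ 2 ∂(gaussM n)) = V at *
    generalize (∫ z, a z ^ 2 * (max (w z) 0) ^ 2 ∂(gaussM n)) = F at *
    generalize (∫ z, ζ z ^ 2 * v z ^ 2 ∂(gaussM n)) = G at *
    generalize (∫ z, w z ∂(gaussM n)) = wb at *
    generalize (∫ z, v z ∂(gaussM n)) = vb at *
    generalize gaussK n = K at *
    have m1 := mul_le_mul_of_nonneg_left h2 (show 0 ≤ τ * r ^ 2 by positivity)
    have m2 := mul_le_mul_of_nonneg_right hτ (show 0 ≤ r ^ 2 * A by positivity)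
    have m3 := mul_le_mul_of_nonneg_right hσ (show 0 ≤ r ^ 4 * V by positivity)
    have m4 : N ^ 2 * K ^ 2 * (τ * r ^ 4 * V) ≤ N ^ 4 * K ^ 4 * (τ * r ^ 4 * V) := by
      gcongr <;> norm_num
    have m5 : N ^ 4 * K ^ 4 * (1 * r ^ 4 * V) ≤ N ^ 4 * K ^ 4 * (τ * r ^ 4 * V) := by
      gcongr
    have m6 : 0 ≤ N ^ 4 * K ^ 4 * (τ * r ^ 4 * V) := by positivity
    linarith
  · have hz : a 0 ^ 2 * (max (∫ z, w z ∂(gaussM n)) 0) ^ 2 = 0 := by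
      by_cases h0 : a 0 = 0
      · rw [h0]; ring
      · have : ∫ z, w z ∂(gaussM n) ≤ 0 := by
          by_contra h
          exact hcase ⟨h0, by linarith⟩
        rw [max_eq_right this]; ring
    rw [hz]
    generalize (∫ z, (g z - c) ^ 2 ∂(gaussM n)) = V at *
    generalize (∫ z, a z ^ 2 * (max (w z) 0) ^ 2 ∂(gaussM n)) = F at *
    generalize (∫ z, ζ z ^ 2 * v z ^ 2 ∂(gaussM n)) = G at *
    generalize (∫ z, v z ∂(gaussM n)) = vb at *
    generalize gaussK n = K at *
    have m1 := mul_le_mul_of_nonneg_left h1 (show 0 ≤ τ * r ^ 2 by positivity)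
    have m3 := mul_le_mul_of_nonneg_right hσ (show 0 ≤ r ^ 4 * V by positivity)
    have m4 : N ^ 2 * K ^ 2 * (τ * r ^ 4 * V) ≤ N ^ 4 * K ^ 4 * (τ * r ^ 4 * V) := by
      gcongr <;> norm_num
    have m5 : 0 ≤ N ^ 4 * K ^ 4 * (τ * r ^ 4 * V) := by positivity
    linarith

end heat

section cutoffs
variable {n : ℕ} {χ : En n → ℝ} {M : ℝ}

lemma C2BddBy.norm_fderiv_sub_le (hχ : ContDiff ℝ (⊤ : ℕ∞) χ) (h : C2BddBy n χ M) (p q : En n) :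
    ‖fderiv ℝ χ q - fderiv ℝ χ p‖ ≤ M * ‖q - p‖ :=
  convex_univ.norm_image_sub_le_of_norm_fderiv_le
    (fun x _ => ((hχ.fderiv_right (m := 1) (by norm_cast)).differentiable (by simp)) x)
    (fun x _ => (h x).2.2) (mem_univ p) (mem_univ q)

lemma C2BddBy.abs_sub_le (hχ : ContDiff ℝ (⊤ : ℕ∞) χ) (h : C2BddBy n χ M) (p q : En n) :
    |χ q - χ p| ≤ M * ‖q - p‖ :=
  convex_univ.norm_image_sub_le_of_norm_fderiv_le
    (fun x _ => (hχ.differentiable (by simp)) x)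
    (fun x _ => (h x).2.1) (mem_univ p) (mem_univ q)

lemma C2BddBy.nonneg (h : C2BddBy n χ M) : 0 ≤ M := (abs_nonneg _).trans (h 0).1

lemma C2BddBy.taylor (hχ : ContDiff ℝ (⊤ : ℕ∞) χ) (h : C2BddBy n χ M) (p y : En n) :
    |χ (p + y) - χ p - fderiv ℝ χ p y| ≤ M * ‖y‖ ^ 2 := by
  have hM := h.nonneg
  have key := (convex_closedBall p ‖y‖).norm_image_sub_le_of_norm_fderiv_le' (𝕜 := ℝ) (f := χ)
    (φ := fderiv ℝ χ p) (C := M * ‖y‖) (x := p) (y := p + y)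
    (fun x _ => (hχ.differentiable (by simp)) x)
    (fun x hx => (h.norm_fderiv_sub_le hχ p x).trans (by
      rw [← dist_eq_norm]; exact mul_le_mul_of_nonneg_left hx hM))
    (by simp) (by simp)
  rw [add_sub_cancel_left, Real.norm_eq_abs] at key
  exact key.trans (le_of_eq (by ring))

lemma fderiv_comp_affine (hχ : Differentiable ℝ χ) (p z e : En n) (k : ℝ) :
    fderiv ℝ (fun z => χ (p + k • z)) z e = k * fderiv ℝ χ (p + k • z) e := by
  have h1 : HasFDerivAt (fun z : En n => p + k • z) (k • ContinuousLinearMap.id ℝ (En n)) z :=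
    ((hasFDerivAt_id z).const_smul k).const_add p
  have h2 : HasFDerivAt (fun z => χ (p + k • z)) _ z := (hχ (p + k • z)).hasFDerivAt.comp z h1
  rw [h2.fderiv]
  simp

lemma C2BddBy.cutoffBound (hχ : ContDiff ℝ (⊤ : ℕ∞) χ) (h : C2BddBy n χ M) {e : En n}
    (he : ‖e‖ = 1) {N r k : ℝ} (hMN : M ≤ N) (hk : 0 ≤ k) (hkr : k ≤ r) (p : En n) :
    CutoffBound n e N r (fun z => χ (p + k • z)) := by
  have hM := h.nonneg
  have hnk : ∀ z : En n, ‖k • z‖ = k * ‖z‖ := fun z => by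
    rw [norm_smul, Real.norm_of_nonneg hk]
  have hN : 0 ≤ N := hM.trans hMN
  have sm : ContDiff ℝ 1 (fun z => χ (p + k • z)) :=
    (hχ.of_le (by norm_cast)).comp (by fun_prop)
  refine ⟨sm, fun z => (h _).1.trans hMN, fun z => ?_, fun z => ?_, ?_⟩
  · have := h.abs_sub_le hχ (p + k • 0) (p + k • z)
    refine this.trans ?_
    rw [smul_zero, add_zero, add_sub_cancel_left, hnk, mul_assoc]
    gcongr
  · rw [fderiv_comp_affine (hχ.differentiable (by simp)), abs_mul, abs_of_nonneg hk, mul_comm N]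
    gcongr
    · exact hk.trans hkr
    · refine ((fderiv ℝ χ (p + k • z)).le_opNorm e).trans ?_
      rw [he, mul_one]
      exact (h _).2.1.trans hMN
  · have t : Tame n (fun z => χ (p + k • z)) := Tame.of_bdd sm.continuous fun z => (h _).1
    have tl : Tame n (fun z => fderiv ℝ χ p (k • z)) :=
      Tame.of_bound (C := ‖fderiv ℝ χ p‖ * k) (k := 1) (by fun_prop) fun z => by
        refine ((fderiv ℝ χ p).le_opNorm _).trans ?_
        rw [hnk, ← mul_assoc]
        gcongr
        simp
    have e1 : ∫ z, χ (p + k • z) ∂(gaussM n) - χ (p + k • 0)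
        = ∫ z, (χ (p + k • z) - χ p - fderiv ℝ χ p (k • z)) ∂(gaussM n) := by
      rw [integral_sub (t.sub (Tame.const _)).integrable tl.integrable,
        integral_sub t.integrable (Tame.const _).integrable]
      have := integral_gaussM_clm n ((fderiv ℝ χ p).comp (k • ContinuousLinearMap.id ℝ (En n)))
      simp only [ContinuousLinearMap.comp_apply, smul_apply, ContinuousLinearMap.id_apply] at this
      rw [this]
      simp
    rw [e1]
    refine abs_integral_le_gaussK fun z => (h.taylor hχ p (k • z)).trans ?_
    rw [hnk, mul_pow, ← mul_assoc]
    have := pow_le_weight z (j := 2) (k := 12) (by norm_num)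
    gcongr

lemma C2BddBy.unitCutoff (hχ : ContDiff ℝ (⊤ : ℕ∞) χ) (h : C2BddBy n χ M) {e : En n}
    (he : ‖e‖ = 1) {N r k : ℝ} (hMN : M ≤ N) (hk : 0 ≤ k) (hkr : k ≤ r) {p : En n}
    (h1 : χ p = 1) (h2 : fderiv ℝ χ p = 0) :
    UnitCutoff n e N r (fun z => χ (p + k • z)) := by
  have hM := h.nonneg
  have hN : 0 ≤ N := hM.trans hMN
  have hr : 0 ≤ r := hk.trans hkr
  have hnk : ∀ z : En n, ‖k • z‖ = k * ‖z‖ := fun z => by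
    rw [norm_smul, Real.norm_of_nonneg hk]
  refine ⟨h.cutoffBound hχ he hMN hk hkr p, by simpa using h1, fun z => ?_, fun z => ?_⟩
  · have := h.taylor hχ p (k • z)
    rw [h1, h2, zero_apply, sub_zero, abs_sub_comm] at this
    refine this.trans ?_
    rw [hnk, mul_pow, ← mul_assoc]
    gcongr
  · rw [fderiv_comp_affine (hχ.differentiable (by simp)), abs_mul, abs_of_nonneg hk]
    have h3 := h.norm_fderiv_sub_le hχ p (p + k • z)
    rw [h2, sub_zero, add_sub_cancel_left, hnk] at h3
    have h4 : |fderiv ℝ χ (p + k • z) e| ≤ M * (k * ‖z‖) := by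
      refine ((fderiv ℝ χ (p + k • z)).le_opNorm e).trans ?_
      rwa [he, mul_one]
    calc k * |fderiv ℝ χ (p + k • z) e| ≤ k * (M * (k * ‖z‖)) := by gcongr
      _ = M * k ^ 2 * ‖z‖ := by ring
      _ ≤ _ := by gcongr

end cutoffs

/-- The symmetric second difference. -/
def symDiff (n : ℕ) (F : En n → ℝ) (x z : En n) : ℝ := 2 * F x - F (x + z) - F (x - z)

lemma integral_symDiff {n : ℕ} {F : En n → ℝ} (hF : Continuous F) {C : ℝ} (hC : ∀ y, |F y| ≤ C)
    (x : En n) (ρ : ℝ) :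
    ∫ z, symDiff n F x (ρ • z) ∂(gaussM n) = 2 * (F x - ∫ z, F (x + ρ • z) ∂(gaussM n)) := by
  have t1 : Tame n (fun z => F (x + ρ • z)) := Tame.of_bdd (by fun_prop) fun z => hC _
  have t2 : Tame n (fun z => F (x - ρ • z)) := Tame.of_bdd (by fun_prop) fun z => hC _
  unfold symDiff
  have h := integral_gaussM_neg n (fun z => F (x + ρ • z))
  simp only [smul_neg, ← sub_eq_add_neg] at h
  rw [integral_sub ((Tame.const _).sub t1).integrable t2.integrable,
    integral_sub (Tame.const _).integrable t1.integrable, h]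
  simp
  ring

lemma tame_symDiff {n : ℕ} {F : En n → ℝ} (hF : Continuous F) {C : ℝ} (hC : ∀ y, |F y| ≤ C)
    (x : En n) (ρ : ℝ) : Tame n (fun z => symDiff n F x (ρ • z)) :=
  ((Tame.const (2 * F x)).sub (Tame.of_bdd (f := fun z => F (x + ρ • z)) (by fun_prop)
    fun z => hC _)).sub (Tame.of_bdd (f := fun z => F (x - ρ • z)) (by fun_prop) fun z => hC _)

lemma pos_part_sq_sub_le (a b : ℝ) :
    (max a 0) ^ 2 - (max b 0) ^ 2 ≤ 2 * max a 0 * (a - b) := by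
  have h1 : max a 0 * a = max a 0 ^ 2 := by
    rcases max_cases a 0 with ⟨h, _⟩ | ⟨h, _⟩ <;> rw [h] <;> ring
  have h2 : b ≤ max b 0 := le_max_left _ _
  nlinarith [sq_nonneg (max a 0 - max b 0), mul_le_mul_of_nonneg_left h2 (le_max_right a 0)]

/-- Data of the problem: cutoffs and a bounded smooth function. -/
structure AuxData (n : ℕ) (η ηb : En n → ℝ) (M M' : ℝ) (u : En n → ℝ) (Mu : ℝ) : Prop where
  hη : ContDiff ℝ (⊤ : ℕ∞) η
  one : ∀ x ∈ ball (0 : En n) (1/4), η x = 1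
  hηb : ContDiff ℝ (⊤ : ℕ∞) ηb
  supp : tsupport ηb ⊆ ball (0 : En n) (1/2)
  bη : C2BddBy n η M
  bηb : C2BddBy n ηb M'
  hu : ContDiff ℝ (⊤ : ℕ∞) u
  bu : ∀ x, |u x| ≤ Mu ∧ ‖fderiv ℝ u x‖ ≤ Mu ∧ ‖fderiv ℝ (fderiv ℝ u) x‖ ≤ Mu

lemma contDiff_dd {n : ℕ} {u : En n → ℝ} (hu : ContDiff ℝ (⊤ : ℕ∞) u) (e : En n) :
    ContDiff ℝ (⊤ : ℕ∞) (dd n e u) :=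
  (hu.fderiv_right (m := (⊤ : ℕ∞)) (by norm_cast)).clm_apply contDiff_const

lemma contDiff_dd2 {n : ℕ} {u : En n → ℝ} (hu : ContDiff ℝ (⊤ : ℕ∞) u) (e : En n) :
    ContDiff ℝ (⊤ : ℕ∞) (dd2 n e u) := contDiff_dd (contDiff_dd hu e) e

/-- The auxiliary function. -/
def auxPhi (n : ℕ) (η ηb u : En n → ℝ) (e : En n) (R κ τ σ : ℝ) (y : En n) : ℝ :=
  (ηb (R⁻¹ • y))^2 * (max (dd2 n e u y) 0)^2
    + τ / R^2 * (η ((2*R)⁻¹ • y))^2 * (dd n e u y)^2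
    + σ / R^4 * (u y - κ)^2

namespace AuxData
variable {n : ℕ} {η ηb : En n → ℝ} {M M' : ℝ} {u : En n → ℝ} {Mu : ℝ} {e : En n}

lemma abs_dd_le (h : AuxData n η ηb M M' u Mu) (he : ‖e‖ = 1) (x : En n) : |dd n e u x| ≤ Mu := by
  refine ((fderiv ℝ u x).le_opNorm e).trans ?_
  rw [he, mul_one]
  exact (h.bu x).2.1

lemma abs_dd2_le (h : AuxData n η ηb M M' u Mu) (he : ‖e‖ = 1) (x : En n) :
    |dd2 n e u x| ≤ Mu := by
  have hd : DifferentiableAt ℝ (fderiv ℝ u) x :=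
    (h.hu.fderiv_right (m := 1) (by norm_cast)).differentiable (by simp) x
  have e1 : dd2 n e u x = fderiv ℝ (fderiv ℝ u) x e e := by
    unfold dd2 dd
    rw [fderiv_clm_apply hd (differentiableAt_const e)]
    simp
  rw [e1]
  refine ((fderiv ℝ (fderiv ℝ u) x e).le_opNorm e).trans ?_
  have := (fderiv ℝ (fderiv ℝ u) x).le_opNorm e
  rw [he, mul_one] at *
  exact this.trans (h.bu x).2.2

lemma dirBound (h : AuxData n η ηb M M' u Mu) (he : ‖e‖ = 1) (x : En n) (ρ : ℝ) :
    DirBound n e (fun z => u (x + ρ • z)) (fun z => ρ * dd n e u (x + ρ • z))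
      (fun z => ρ ^ 2 * dd2 n e u (x + ρ • z)) := by
  have d1 : Differentiable ℝ u := h.hu.differentiable (by simp)
  have d2 : Differentiable ℝ (dd n e u) := (contDiff_dd h.hu e).differentiable (by simp)
  have c3 := (contDiff_dd2 h.hu e).continuous
  have d2' : Differentiable ℝ (fun z => dd n e u (x + ρ • z)) := d2.comp (by fun_prop)
  refine ⟨d1.comp (by fun_prop), d2'.const_mul ρ, fun z => fderiv_comp_affine d1 x z e ρ,
    fun z => ?_, ?_, ?_, ?_⟩
  · rw [fderiv_const_mul (d2' z), smul_apply, smul_eq_mul, fderiv_comp_affine d2, dd2]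
    ring
  · exact Tame.of_bdd (d1.continuous.comp (by fun_prop)) fun z => (h.bu _).1
  · exact (Tame.const ρ).mul (Tame.of_bdd (d2.continuous.comp (by fun_prop)) fun z =>
      h.abs_dd_le he _)
  · exact (Tame.const _).mul (Tame.of_bdd (c3.comp (by fun_prop)) fun z => h.abs_dd2_le he _)

lemma continuous_auxPhi (h : AuxData n η ηb M M' u Mu) (e : En n) (R κ τ σ : ℝ) :
    Continuous (auxPhi n η ηb u e R κ τ σ) := by
  have c0 := h.hη.continuous
  have c1 := h.hηb.continuous
  have c2 := h.hu.continuous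
  have c3 := (contDiff_dd h.hu e).continuous
  have c4 := (contDiff_dd2 h.hu e).continuous
  unfold auxPhi
  fun_prop

lemma abs_auxPhi_le (h : AuxData n η ηb M M' u Mu) (he : ‖e‖ = 1) (R κ τ σ : ℝ) (y : En n) :
    |auxPhi n η ηb u e R κ τ σ y| ≤ M' ^ 2 * Mu ^ 2 + |τ / R ^ 2| * M ^ 2 * Mu ^ 2
      + |σ / R ^ 4| * (Mu + |κ|) ^ 2 := by
  have b1 := (h.bη ((2*R)⁻¹ • y)).1
  have b2 := (h.bηb (R⁻¹ • y)).1
  have b3 := h.abs_dd_le he y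
  have b4 := h.abs_dd2_le he y
  have b5 : |u y - κ| ≤ Mu + |κ| := (abs_sub _ _).trans (by linarith [(h.bu y).1])
  have b6 : |max (dd2 n e u y) 0| ≤ Mu := by
    rw [abs_of_nonneg (le_max_right _ _)]
    exact max_le ((le_abs_self _).trans b4) ((abs_nonneg _).trans b4)
  unfold auxPhi
  refine (abs_add_three _ _ _).trans ?_
  simp only [abs_mul, abs_pow]
  gcongr

/-- Jensen-type inequality for Gaussian averages. -/
lemma average_le (h : AuxData n η ηb M M' u Mu) (he : ‖e‖ = 1) {R : ℝ} (hR : 0 < R)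
    {κ τ σ : ℝ} (hτ : 52 * gaussK n ^ 2 * (1 + |M| + |M'|) ^ 2 ≤ τ)
    (hσ : 2500 * gaussK n ^ 4 * (1 + |M| + |M'|) ^ 4 * τ ≤ σ) (x : En n) {ρ : ℝ} (hρ : 0 < ρ) :
    (ηb (R⁻¹ • x))^2 * (max (∫ z, dd2 n e u (x + ρ • z) ∂(gaussM n)) 0)^2
      + τ / R^2 * (η ((2*R)⁻¹ • x))^2 * (∫ z, dd n e u (x + ρ • z) ∂(gaussM n)) ^ 2
      + σ / R^4 * (∫ z, (u (x + ρ • z) - κ) ∂(gaussM n)) ^ 2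
      ≤ ∫ z, auxPhi n η ηb u e R κ τ σ (x + ρ • z) ∂(gaussM n) := by
  set N := 1 + |M| + |M'| with hNdef
  have hN : 1 ≤ N := by linarith [abs_nonneg M, abs_nonneg M']
  have hMN : M ≤ N := by linarith [le_abs_self M, abs_nonneg M']
  have hMN' : M' ≤ N := by linarith [le_abs_self M', abs_nonneg M]
  set r := ρ / R with hrdef
  have hr : 0 < r := by positivity
  set a : En n → ℝ := fun z => ηb (R⁻¹ • x + (R⁻¹ * ρ) • z) with ha_def
  set ζ : En n → ℝ := fun z => η ((2*R)⁻¹ • x + ((2*R)⁻¹ * ρ) • z) with hζ_def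
  have k1 : R⁻¹ * ρ ≤ r := by rw [hrdef, div_eq_inv_mul]
  have k2 : (2*R)⁻¹ * ρ ≤ r := by
    rw [hrdef, div_eq_inv_mul]
    gcongr
    linarith
  have ea : ∀ z, ηb (R⁻¹ • (x + ρ • z)) = a z := fun z => by
    simp only [ha_def, smul_add, smul_smul]
  have eζ : ∀ z, η ((2*R)⁻¹ • (x + ρ • z)) = ζ z := fun z => by
    simp only [hζ_def, smul_add, smul_smul]
  have hone : ∀ p : En n, 2 • p ∈ tsupport ηb → η p = 1 ∧ fderiv ℝ η p = 0 := fun p hp => by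
    have hb := h.supp hp
    have hmem : p ∈ ball (0 : En n) (1/4) := by
      rw [mem_ball_zero_iff, ← Nat.cast_smul_eq_nsmul ℝ, norm_smul] at hb
      rw [mem_ball_zero_iff]
      norm_num at hb
      linarith
    refine ⟨h.one p hmem, ?_⟩
    have : η =ᶠ[nhds p] fun _ => 1 :=
      Filter.eventuallyEq_of_mem (isOpen_ball.mem_nhds hmem) h.one
    rw [this.fderiv_eq]
    simp
  have h2 : ∀ q : En n, 2 • ((2*R)⁻¹ • q) = R⁻¹ • q := fun q => by
    rw [← Nat.cast_smul_eq_nsmul ℝ, smul_smul]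
    congr 1
    push_cast
    field_simp
  have hζ : CutoffBound n e N r ζ := h.bη.cutoffBound h.hη he hMN (by positivity) k2 _
  have ha : CutoffBound n e N r a := h.bηb.cutoffBound h.hηb he hMN' (by positivity) k1 _
  have key := heat_inequality he hr.le hN (h.dirBound he x ρ) hζ ha (fun h0 => ?_) (fun z hz => ?_)
    (κ := κ) hτ hσ
  · have e1 : ∀ z, a z ^ 2 * (max (ρ ^ 2 * dd2 n e u (x + ρ • z)) 0) ^ 2
        + τ * r ^ 2 * (ζ z ^ 2 * (ρ * dd n e u (x + ρ • z)) ^ 2)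
        + σ * r ^ 4 * (u (x + ρ • z) - κ) ^ 2
        = ρ ^ 4 * auxPhi n η ηb u e R κ τ σ (x + ρ • z) := fun z => by
      have : max (ρ ^ 2 * dd2 n e u (x + ρ • z)) 0 = ρ ^ 2 * max (dd2 n e u (x + ρ • z)) 0 := by
        rw [mul_max_of_nonneg _ _ (by positivity), mul_zero]
      rw [this, auxPhi, ea, eζ, hrdef]
      field_simp
    have hw0 : ∀ y : ℝ, max (ρ ^ 2 * y) 0 = ρ ^ 2 * max y 0 := fun y => by
      rw [mul_max_of_nonneg _ _ (by positivity), mul_zero]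
    simp only [e1, integral_const_mul] at key
    rw [hw0] at key
    have ea0 : a 0 = ηb (R⁻¹ • x) := by simp [ha_def]
    have eζ0 : ζ 0 = η ((2*R)⁻¹ • x) := by simp [hζ_def]
    rw [ea0, eζ0] at key
    set W := ∫ z, dd2 n e u (x + ρ • z) ∂(gaussM n)
    set V := ∫ z, dd n e u (x + ρ • z) ∂(gaussM n)
    set U := ∫ z, (u (x + ρ • z) - κ) ∂(gaussM n)
    set Φ := ∫ z, auxPhi n η ηb u e R κ τ σ (x + ρ • z) ∂(gaussM n)
    refine le_of_mul_le_mul_left (le_trans (le_of_eq ?_) key) (show 0 < ρ ^ 4 by positivity)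
    rw [hrdef]
    field_simp
  · have h3 : R⁻¹ • x ∈ tsupport ηb := subset_tsupport _ (by
      simpa [ha_def] using h0)
    rw [← h2] at h3
    exact h.bη.unitCutoff h.hη he hMN (by positivity) k2 (hone _ h3).1 (hone _ h3).2
  · have h3 : R⁻¹ • x + (R⁻¹ * ρ) • z ∈ tsupport ηb := by
      rcases hz with hz | hz
      · exact subset_tsupport _ hz
      · refine support_fderiv_subset ℝ ?_
        rw [fderiv_comp_affine (h.hηb.differentiable (by simp))] at hz
        intro h4
        rw [h4] at hz
        simp at hz
    have h4 : R⁻¹ • x + (R⁻¹ * ρ) • z = 2 • ((2*R)⁻¹ • x + ((2*R)⁻¹ * ρ) • z) := by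
      rw [smul_add, ← smul_smul, ← smul_smul, h2, h2]
    rw [h4] at h3
    refine ⟨(hone _ h3).1, ?_⟩
    rw [hζ_def, fderiv_comp_affine (h.hη.differentiable (by simp)), (hone _ h3).2]
    simp

/-- Gaussian averages of the auxiliary function control the auxiliary function of averages,
in linearized form. -/
lemma integral_symDiff_nonneg (h : AuxData n η ηb M M' u Mu) (he : ‖e‖ = 1) {R : ℝ} (hR : 0 < R)
    {κ τ σ : ℝ} (hτ : 52 * gaussK n ^ 2 * (1 + |M| + |M'|) ^ 2 ≤ τ)
    (hσ : 2500 * gaussK n ^ 4 * (1 + |M| + |M'|) ^ 4 * τ ≤ σ) (x : En n) {ρ : ℝ} (hρ : 0 < ρ) :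
    0 ≤ ∫ z, (2 * (ηb (R⁻¹ • x))^2 * max (dd2 n e u x) 0 * symDiff n (dd2 n e u) x (ρ • z)
      + 2 * τ / R^2 * (η ((2*R)⁻¹ • x))^2 * dd n e u x * symDiff n (dd n e u) x (ρ • z)
      + 2 * σ / R^4 * (u x - κ) * symDiff n (fun y => u y - κ) x (ρ • z)
      - symDiff n (auxPhi n η ηb u e R κ τ σ) x (ρ • z)) ∂(gaussM n) := by
  have c1 := h.hu.continuous
  have c2 := (contDiff_dd h.hu e).continuous
  have c3 := (contDiff_dd2 h.hu e).continuous
  have c4 := h.continuous_auxPhi e R κ τ σ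
  have c5 : Continuous (fun y => u y - κ) := c1.sub continuous_const
  have bk : ∀ y, |u y - κ| ≤ Mu + |κ| := fun y =>
    (abs_sub _ _).trans (by linarith [(h.bu y).1])
  have t1 := tame_symDiff c3 (h.abs_dd2_le he) x ρ
  have t2 := tame_symDiff c2 (h.abs_dd_le he) x ρ
  have t3 := tame_symDiff c5 bk x ρ
  have t4 := tame_symDiff c4 (h.abs_auxPhi_le he R κ τ σ) x ρ
  have t1' := (Tame.const (2 * (ηb (R⁻¹ • x))^2 * max (dd2 n e u x) 0)).mul t1
  have t2' := (Tame.const (2 * τ / R^2 * (η ((2*R)⁻¹ • x))^2 * dd n e u x)).mul t2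
  have t3' := (Tame.const (2 * σ / R^4 * (u x - κ))).mul t3
  rw [integral_sub ((t1'.add t2').add t3').integrable t4.integrable,
    integral_add (t1'.add t2').integrable t3'.integrable,
    integral_add t1'.integrable t2'.integrable, integral_const_mul, integral_const_mul,
    integral_const_mul, integral_symDiff c3 (h.abs_dd2_le he),
    integral_symDiff c2 (h.abs_dd_le he), integral_symDiff c5 bk,
    integral_symDiff c4 (h.abs_auxPhi_le he R κ τ σ)]
  have key2 := h.average_le he hR (κ := κ) hτ hσ x hρ
  set W := ∫ z, dd2 n e u (x + ρ • z) ∂(gaussM n)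
  set V := ∫ z, dd n e u (x + ρ • z) ∂(gaussM n)
  set U := ∫ z, (u (x + ρ • z) - κ) ∂(gaussM n)
  set Φ := ∫ z, auxPhi n η ηb u e R κ τ σ (x + ρ • z) ∂(gaussM n)
  have hτ0 : 0 ≤ τ := le_trans (by positivity) hτ
  have hσ0 : 0 ≤ σ := le_trans (by positivity) hσ
  have p1 := pos_part_sq_sub_le (dd2 n e u x) W
  have p2 : 2 * dd n e u x * (dd n e u x - V) ≥ (dd n e u x) ^ 2 - V ^ 2 := by
    nlinarith [sq_nonneg (dd n e u x - V)]
  have p3 : 2 * (u x - κ) * ((u x - κ) - U) ≥ (u x - κ) ^ 2 - U ^ 2 := by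
    nlinarith [sq_nonneg ((u x - κ) - U)]
  have m1 := mul_le_mul_of_nonneg_left p1 (sq_nonneg (ηb (R⁻¹ • x)))
  have m2 := mul_le_mul_of_nonneg_left p2
    (show 0 ≤ τ / R^2 * (η ((2*R)⁻¹ • x))^2 by positivity)
  have m3 := mul_le_mul_of_nonneg_left p3 (show 0 ≤ σ / R^4 by positivity)
  have e2 : auxPhi n η ηb u e R κ τ σ x = (ηb (R⁻¹ • x))^2 * (max (dd2 n e u x) 0)^2
    + τ / R^2 * (η ((2*R)⁻¹ • x))^2 * (dd n e u x)^2 + σ / R^4 * (u x - κ)^2 := rfl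
  rw [e2]
  have e3 : 2 * τ / R ^ 2 = 2 * (τ / R ^ 2) := by ring
  have e4 : 2 * σ / R ^ 4 = 2 * (σ / R ^ 4) := by ring
  rw [e3, e4]
  linarith

end AuxData

/-- `F` has a first-order Taylor expansion at `x` with quadratic error and linear part `L`, and
its symmetric second differences along rays are asymptotic to the quadratic form of `B`. -/
structure SecondOrder (n : ℕ) (F : En n → ℝ) (x : En n) (L : En n →L[ℝ] ℝ)
    (B : En n →L[ℝ] En n →L[ℝ] ℝ) : Prop where
  taylor : (fun z => F (x + z) - F x - L z) =O[nhds 0] fun z => ‖z‖ ^ 2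
  lim : ∀ z, Tendsto (fun r : ℝ => symDiff n F x (r • z) / r ^ 2) (nhdsWithin 0 (Ioi 0))
    (nhds (B z z))

namespace SecondOrder
variable {n : ℕ} {F G : En n → ℝ} {x : En n} {L L' : En n →L[ℝ] ℝ}
  {B B' : En n →L[ℝ] En n →L[ℝ] ℝ}

lemma hasFDerivAt (h : SecondOrder n F x L B) : HasFDerivAt F L x := by
  rw [hasFDerivAt_iff_isLittleO_nhds_zero]
  refine h.taylor.trans_isLittleO ?_
  have := Asymptotics.isLittleO_norm_pow_id (E' := En n) (n := 2) (by norm_num)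
  exact this

lemma tendsto_div (h : SecondOrder n F x L B) (z : En n) :
    Tendsto (fun r : ℝ => (F (x + r • z) - F x) / r) (nhdsWithin 0 (Ioi 0)) (nhds (L z)) := by
  refine ((h.hasFDerivAt.hasLineDerivAt z).tendsto_slope_zero_right).congr fun r => ?_
  rw [smul_eq_mul, inv_mul_eq_div]

lemma tendsto_div_neg (h : SecondOrder n F x L B) (z : En n) :
    Tendsto (fun r : ℝ => (F (x - r • z) - F x) / r) (nhdsWithin 0 (Ioi 0)) (nhds (-L z)) := by
  have := h.tendsto_div (-z)
  simpa [← sub_eq_add_neg] using this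

lemma isBigO_norm (h : SecondOrder n F x L B) :
    (fun z => F (x + z) - F x) =O[nhds 0] fun z => ‖z‖ := by
  have h1 : (fun z => F (x + z) - F x - L z) =O[nhds 0] fun z : En n => ‖z‖ := by
    have := Asymptotics.isLittleO_norm_pow_id (E' := En n) (n := 2) (by norm_num)
    exact (h.taylor.trans_isLittleO this).isBigO.norm_right
  have h2 : (fun z => L z) =O[nhds 0] fun z : En n => ‖z‖ :=
    (L.isBigO_id (nhds 0)).norm_right
  exact (h1.add h2).congr_left fun z => by ring

lemma congr (h : SecondOrder n F x L B) (hFG : F =ᶠ[nhds x] G) : SecondOrder n G x L B := by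
  have hx : F x = G x := hFG.eq_of_nhds
  have t1 : Tendsto (fun z : En n => x + z) (nhds 0) (nhds x) := by
    have : Continuous fun z : En n => x + z := by fun_prop
    simpa using this.tendsto 0
  refine ⟨h.taylor.congr' ?_ EventuallyEq.rfl, fun z => (h.lim z).congr' ?_⟩
  · filter_upwards [t1.eventually hFG] with z hz
    rw [hz, hx]
  · have t2 : Tendsto (fun r : ℝ => x + r • z) (nhdsWithin 0 (Ioi 0)) (nhds x) := by
      have : Continuous fun r : ℝ => x + r • z := by fun_prop
      simpa using (this.tendsto 0).mono_left nhdsWithin_le_nhds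
    have t3 : Tendsto (fun r : ℝ => x - r • z) (nhdsWithin 0 (Ioi 0)) (nhds x) := by
      have : Continuous fun r : ℝ => x - r • z := by fun_prop
      simpa using (this.tendsto 0).mono_left nhdsWithin_le_nhds
    filter_upwards [t2.eventually hFG, t3.eventually hFG] with r h1 h2
    simp only [symDiff]
    rw [h1, h2, hx]

lemma add (h : SecondOrder n F x L B) (h' : SecondOrder n G x L' B') :
    SecondOrder n (fun y => F y + G y) x (L + L') (B + B') := by
  refine ⟨(h.taylor.add h'.taylor).congr_left fun z => ?_,
    fun z => ((h.lim z).add (h'.lim z)).congr fun r => ?_⟩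
  · simp only [add_apply]; ring
  · simp only [symDiff]; ring

lemma mul (h : SecondOrder n F x L B) (h' : SecondOrder n G x L' B') :
    SecondOrder n (fun y => F y * G y) x (F x • L' + G x • L)
      (F x • B' + G x • B - (2 : ℝ) • L.smulRight L') := by
  refine ⟨?_, fun z => ?_⟩
  · have h1 := (h.isBigO_norm.mul h'.isBigO_norm).congr_right fun z : En n => (sq ‖z‖).symm
    refine (((h.taylor.const_mul_left (G x)).add (h'.taylor.const_mul_left (F x))).add
      h1).congr_left fun z => ?_
    simp only [add_apply, smul_apply, smul_eq_mul]; ring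
  · have := ((((h'.lim z).const_mul (F x)).add ((h.lim z).const_mul (G x))).sub
      ((h.tendsto_div z).mul (h'.tendsto_div z))).sub
      ((h.tendsto_div_neg z).mul (h'.tendsto_div_neg z))
    have e : ((F x • B' + G x • B - (2 : ℝ) • L.smulRight L') z) z
      = F x * B' z z + G x * B z z - L z * L' z - -L z * -L' z := by
      simp only [add_apply, sub_apply, smul_apply, smul_eq_mul,
        ContinuousLinearMap.smulRight_apply]
      ring
    rw [e]
    refine this.congr' ?_
    filter_upwards [self_mem_nhdsWithin] with r (hr : 0 < r)
    simp only [symDiff]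
    field_simp
    ring

lemma zero : SecondOrder n (fun _ => 0) x 0 0 := by
  refine ⟨?_, fun z => ?_⟩
  · simpa using Asymptotics.isBigO_zero _ _
  · simp [symDiff]

lemma pos_part_sq (h : SecondOrder n F x L B) :
    ∃ L' B', SecondOrder n (fun y => max (F y) 0 ^ 2) x L' B' := by
  have hc := h.hasFDerivAt.continuousAt
  rcases lt_trichotomy (F x) 0 with h0 | h0 | h0
  · refine ⟨0, 0, zero.congr ?_⟩
    filter_upwards [hc.eventually (gt_mem_nhds h0)] with y hy
    rw [max_eq_right hy.le]; simp
  · refine ⟨0, -L.smulRight L, ?_, fun z => ?_⟩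
    · have h1 := (h.isBigO_norm.mul h.isBigO_norm).congr_right fun z : En n => (sq ‖z‖).symm
      refine (Asymptotics.IsBigO.of_norm_le fun z => ?_).trans h1
      rw [h0]
      simp only [max_self, sub_zero, zero_apply, Real.norm_eq_abs, ne_eq, OfNat.ofNat_ne_zero,
        not_false_eq_true, zero_pow, abs_pow]
      rw [abs_of_nonneg (le_max_right (F (x + z)) 0), ← sq, ← sq_abs (F (x + z))]
      have : max (F (x + z)) 0 ≤ |F (x + z)| := max_le (le_abs_self _) (abs_nonneg _)
      gcongr
    · have e : (-L.smulRight L : En n →L[ℝ] En n →L[ℝ] ℝ) z z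
          = -(max (L z) 0 ^ 2 + max (-L z) 0 ^ 2) := by
        simp only [neg_apply, ContinuousLinearMap.smulRight_apply, smul_apply, smul_eq_mul]
        rcases le_total 0 (L z) with h1 | h1
        · rw [max_eq_left h1, max_eq_right (by linarith)]; ring
        · rw [max_eq_right h1, max_eq_left (by linarith)]; ring
      rw [e]
      refine ((((h.tendsto_div z).max tendsto_const_nhds).pow 2).add
        (((h.tendsto_div_neg z).max tendsto_const_nhds).pow 2)).neg.congr' ?_
      filter_upwards [self_mem_nhdsWithin] with r (hr : 0 < r)
      have hm : ∀ t : ℝ, max (t / r) 0 = max t 0 / r := fun t => by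
        rw [← max_div_div_right hr.le, zero_div]
      simp only [symDiff, h0, sub_zero, hm, max_self]
      field_simp
      ring
  · refine ⟨_, _, (h.mul h).congr ?_⟩
    filter_upwards [hc.eventually (lt_mem_nhds h0)] with y hy
    rw [max_eq_left hy.le, sq]

lemma of_contDiff (hF : ContDiff ℝ (⊤ : ℕ∞) F) (x : En n) :
    ∃ L B, SecondOrder n F x L B := by
  have hd : Differentiable ℝ F := hF.differentiable (by simp)
  have hF' : ContDiff ℝ (⊤ : ℕ∞) (fderiv ℝ F) := hF.fderiv_right (m := (⊤ : ℕ∞)) (by norm_cast)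
  have hd' : Differentiable ℝ (fderiv ℝ F) := hF'.differentiable (by simp)
  refine ⟨fderiv ℝ F x, -fderiv ℝ (fderiv ℝ F) x, ?_, fun z => ?_⟩
  · obtain ⟨K, t, ht, hK⟩ :=
      (hF'.contDiffAt.of_le (m := 1) (by norm_cast) : ContDiffAt ℝ 1 _ x).exists_lipschitzOnWith
    obtain ⟨ε, hε, hb⟩ := Metric.mem_nhds_iff.1 ht
    refine Asymptotics.IsBigO.of_bound K ?_
    filter_upwards [ball_mem_nhds (0 : En n) hε] with z hz
    rw [mem_ball_zero_iff] at hz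
    have key := (convex_closedBall x ‖z‖).norm_image_sub_le_of_norm_fderiv_le' (𝕜 := ℝ) (f := F)
      (φ := fderiv ℝ F x) (C := K * ‖z‖) (x := x) (y := x + z)
      (fun y _ => hd y)
      (fun y hy => by
        have := hK.dist_le_mul y (hb (lt_of_le_of_lt hy hz)) x (mem_of_mem_nhds ht)
        rw [dist_eq_norm] at this
        exact this.trans (mul_le_mul_of_nonneg_left hy K.2))
      (by simp) (by simp)
    rw [add_sub_cancel_left] at key
    refine key.trans (le_of_eq ?_)
    rw [norm_pow, norm_norm]; ring
  · have hl : ∀ (z : En n) (r : ℝ), HasDerivAt (fun r : ℝ => F (x + r • z))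
        (fderiv ℝ F (x + r • z) z) r := fun z r => by
      have h1 : HasDerivAt (fun r : ℝ => x + r • z) z r := by
        simpa using ((hasDerivAt_id r).smul_const z).const_add x
      exact (hd _).hasFDerivAt.comp_hasDerivAt r h1
    have hs : ∀ r : ℝ, HasDerivAt (fun r : ℝ => symDiff n F x (r • z))
        (-fderiv ℝ F (x + r • z) z - fderiv ℝ F (x + r • -z) (-z)) r := fun r => by
      have := ((hl z r).const_sub (2 * F x)).sub (hl (-z) r)
      refine this.congr_of_eventuallyEq (Eventually.of_forall fun t => ?_)
      simp [symDiff, ← sub_eq_add_neg]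
    have hl2 : ∀ z : En n, Tendsto (fun r : ℝ => r⁻¹ •
        (fderiv ℝ F (x + r • z) - fderiv ℝ F x)) (nhdsWithin 0 (Ioi 0))
        (nhds (fderiv ℝ (fderiv ℝ F) x z)) := fun z =>
      ((hd' x).hasFDerivAt.hasLineDerivAt z).tendsto_slope_zero_right
    have hcont : Continuous (fun r : ℝ => symDiff n F x (r • z)) :=
      continuous_iff_continuousAt.2 fun r => (hs r).continuousAt
    refine HasDerivAt.lhopital_zero_nhdsGT (Eventually.of_forall hs)
      (g' := fun r => 2 * r) (Eventually.of_forall fun r => by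
        simpa using hasDerivAt_pow 2 r) ?_ ?_ ?_ ?_
    · filter_upwards [self_mem_nhdsWithin] with r (hr : 0 < r)
      positivity
    · have := (hcont.tendsto 0).mono_left (nhdsWithin_le_nhds (s := Ioi 0))
      convert this using 2
      simp [symDiff]; ring
    · have : Continuous fun r : ℝ => r ^ 2 := by fun_prop
      simpa using (this.tendsto 0).mono_left (nhdsWithin_le_nhds (s := Ioi 0))
    · have ap : ∀ z : En n, Tendsto (fun r : ℝ => (r⁻¹ •
        (fderiv ℝ F (x + r • z) - fderiv ℝ F x)) z) (nhdsWithin 0 (Ioi 0))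
        (nhds (fderiv ℝ (fderiv ℝ F) x z z)) := fun z =>
        ((ContinuousLinearMap.apply ℝ ℝ z).continuous.tendsto _).comp (hl2 z)
      have := ((ap z).add (ap (-z))).const_mul (-(1/2) : ℝ)
      have e : (-fderiv ℝ (fderiv ℝ F) x) z z = -(1/2) * (fderiv ℝ (fderiv ℝ F) x z z
          + fderiv ℝ (fderiv ℝ F) x (-z) (-z)) := by
        simp only [neg_apply, map_neg]; ring
      rw [e]
      refine this.congr' ?_
      filter_upwards [self_mem_nhdsWithin] with r (hr : 0 < r)
      simp only [smul_apply, sub_apply, smul_eq_mul, map_neg]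
      field_simp
      ring

lemma exists_symDiff_le (h : SecondOrder n F x L B) {C : ℝ} (hC : ∀ y, |F y| ≤ C) :
    ∃ C', ∀ z, |symDiff n F x z| ≤ C' * min 1 (‖z‖ ^ 2) := by
  obtain ⟨c, hc⟩ := h.taylor.bound
  obtain ⟨ε, hε, hb⟩ := Metric.eventually_nhds_iff_ball.1 hc
  have hC0 : 0 ≤ C := (abs_nonneg _).trans (hC x)
  have hm : 0 < min 1 (ε ^ 2) := by positivity
  refine ⟨2 * |c| + 4 * C + 4 * C / min 1 (ε ^ 2), fun z => ?_⟩
  have hA : |symDiff n F x z| ≤ 4 * C := by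
    unfold symDiff
    have h1 := abs_le.1 (hC x)
    have h2 := abs_le.1 (hC (x + z))
    have h3 := abs_le.1 (hC (x - z))
    rw [abs_le]
    constructor <;> linarith
  have hz0 : 0 ≤ min 1 (‖z‖ ^ 2) := by positivity
  by_cases hz : ‖z‖ < ε
  · have h1 := hb z (by simpa using hz)
    have h2 := hb (-z) (by simpa using hz)
    have h3 : |symDiff n F x z| ≤ 2 * |c| * ‖z‖ ^ 2 := by
      have e : symDiff n F x z = -(F (x + z) - F x - L z) - (F (x + -z) - F x - L (-z)) := by
        simp only [symDiff, map_neg, ← sub_eq_add_neg]; ring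
      rw [e]
      refine (abs_sub _ _).trans ?_
      rw [abs_neg]
      simp only [norm_neg, norm_pow, norm_norm] at h1 h2
      rw [Real.norm_eq_abs] at h1 h2
      nlinarith [le_abs_self c, sq_nonneg ‖z‖]
    have h5 : 0 ≤ 4 * C / min 1 (ε ^ 2) := by positivity
    rcases le_total 1 (‖z‖ ^ 2) with h4 | h4
    · rw [min_eq_left h4]
      nlinarith [abs_nonneg c]
    · rw [min_eq_right h4]
      nlinarith [abs_nonneg c, sq_nonneg ‖z‖, mul_nonneg h5 (sq_nonneg ‖z‖)]
  · push Not at hz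
    have h1 : min 1 (ε ^ 2) ≤ min 1 (‖z‖ ^ 2) := by gcongr
    calc |symDiff n F x z| ≤ 4 * C := hA
      _ = 4 * C / min 1 (ε ^ 2) * min 1 (ε ^ 2) := by field_simp
      _ ≤ 4 * C / min 1 (ε ^ 2) * min 1 (‖z‖ ^ 2) := by gcongr
      _ ≤ _ := by
        gcongr
        nlinarith [abs_nonneg c]

end SecondOrder

section kernel
variable {n : ℕ} {s : ℝ}

lemma integrable_min_mul_rpow (hn : 0 < n) (hs0 : 0 < s) (hs1 : s < 1) :
    Integrable (fun z : En n => min 1 (‖z‖ ^ 2) * ‖z‖ ^ (-((n:ℝ) + 2 * s))) := by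
  have : Nonempty (Fin n) := ⟨⟨0, hn⟩⟩
  rw [integrable_fun_norm_addHaar (volume : Measure (En n))
    (f := fun r : ℝ => min 1 (r ^ 2) * r ^ (-((n:ℝ) + 2 * s))), finrank_euclideanSpace,
    Fintype.card_fin, ← Ioc_union_Ioi_eq_Ioi (zero_le_one' ℝ), integrableOn_union]
  have hp : ∀ r : ℝ, 0 < r → r ^ (n - 1) = r ^ ((n:ℝ) - 1) := fun r hr => by
    rw [← Real.rpow_natCast, Nat.cast_sub hn, Nat.cast_one]
  constructor
  · rw [integrableOn_Ioc_iff_integrableOn_Ioo]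
    refine ((intervalIntegral.integrableOn_Ioo_rpow_iff (s := 1 - 2 * s) one_pos).2
      (by linarith)).congr_fun (fun r hr => ?_) measurableSet_Ioo
    have h1 : r ^ 2 ≤ 1 := pow_le_one₀ hr.1.le hr.2.le
    dsimp only
    rw [min_eq_right h1, hp r hr.1, smul_eq_mul, ← Real.rpow_natCast r 2, ← Real.rpow_add hr.1,
      ← Real.rpow_add hr.1]
    congr 1
    push_cast
    ring
  · refine (integrableOn_Ioi_rpow_of_lt (a := -1 - 2 * s) (by linarith) one_pos).congr_fun
      (fun r hr => ?_) measurableSet_Ioi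
    have hr : 1 < r := hr
    have hr0 : 0 < r := one_pos.trans hr
    have h1 : 1 ≤ r ^ 2 := one_le_pow₀ hr.le
    dsimp only
    rw [min_eq_left h1, hp r hr0, smul_eq_mul, one_mul, ← Real.rpow_add hr0]
    congr 1
    ring

lemma fracLap_eq (hn : 0 < n) (hs0 : 0 < s) (hs1 : s < 1) {F : En n → ℝ} (hF : Continuous F)
    {x : En n} {C C' : ℝ} (hC : ∀ y, |F y| ≤ C)
    (hC' : ∀ z, |symDiff n F x z| ≤ C' * min 1 (‖z‖ ^ 2)) :
    fracLap n s F x = 1 / 2 * ∫ z, symDiff n F x z * (cns n s * ‖z‖ ^ (-((n:ℝ) + 2 * s))) := by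
  have hC0 : 0 ≤ C := (abs_nonneg _).trans (hC x)
  set k : En n → ℝ := fun z => cns n s * ‖z‖ ^ (-((n:ℝ) + 2 * s)) with hk
  have km : Measurable k := by fun_prop
  have int0 := integrable_min_mul_rpow hn hs0 hs1
  have ks : ∀ z, k (-z) = k z := fun z => by simp [hk]
  have hset : ∀ ε : ℝ, MeasurableSet {z : En n | ε ≤ ‖z‖} := fun ε =>
    (isClosed_le continuous_const continuous_norm).measurableSet
  have hkb : ∀ (m C₁ : ℝ) (z : En n), |m| ≤ C₁ * min 1 (‖z‖ ^ 2) →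
      ‖m * k z‖ ≤ C₁ * |cns n s| * (min 1 (‖z‖ ^ 2) * ‖z‖ ^ (-((n:ℝ) + 2 * s))) := by
    intro m C₁ z hm
    have h0 : 0 ≤ ‖z‖ ^ (-((n:ℝ) + 2 * s)) := by positivity
    rw [hk, Real.norm_eq_abs, abs_mul, abs_mul, abs_of_nonneg h0]
    calc |m| * (|cns n s| * ‖z‖ ^ (-((n:ℝ) + 2 * s)))
        ≤ C₁ * min 1 (‖z‖ ^ 2) * (|cns n s| * ‖z‖ ^ (-((n:ℝ) + 2 * s))) := by gcongr
      _ = _ := by ring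
  have intm : ∀ ε : ℝ, 0 < ε → ∀ G : En n → ℝ, Continuous G → (∀ z, |G z| ≤ 2 * C) →
      Integrable ({z : En n | ε ≤ ‖z‖}.indicator (fun z => G z * k z)) := by
    intro ε hε G hG hGC
    refine (int0.const_mul (2 * C / min 1 (ε ^ 2) * |cns n s|)).mono'
      (((hG.measurable.mul km).indicator (hset ε)).aestronglyMeasurable)
      (Eventually.of_forall fun z => ?_)
    by_cases hz : z ∈ {z : En n | ε ≤ ‖z‖}
    · rw [indicator_of_mem hz]
      refine hkb _ _ _ ((hGC z).trans ?_)
      have hz : ε ≤ ‖z‖ := hz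
      have hm : 0 < min 1 (ε ^ 2) := by positivity
      calc 2 * C = 2 * C / min 1 (ε ^ 2) * min 1 (ε ^ 2) := by field_simp
        _ ≤ _ := by gcongr
    · rw [indicator_of_notMem hz, norm_zero]
      positivity
  have e1 : ∀ ε : ℝ, 0 < ε → ∫ y in {y : En n | ε ≤ dist y x}, (F x - F y) * k (x - y)
      = 1 / 2 * ∫ z, {z : En n | ε ≤ ‖z‖}.indicator (fun z => symDiff n F x z * k z) z := by
    intro ε hε
    have hset' : MeasurableSet {y : En n | ε ≤ dist y x} :=
      (isClosed_le continuous_const (continuous_id.dist continuous_const)).measurableSet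
    have a1 : ∫ y in {y : En n | ε ≤ dist y x}, (F x - F y) * k (x - y)
        = ∫ z, {z : En n | ε ≤ ‖z‖}.indicator (fun z => (F x - F (x + z)) * k z) z := by
      rw [← integral_indicator hset', ← integral_add_left_eq_self _ x]
      congr 1 with z
      simp only [indicator, mem_ofPred_eq, dist_eq_norm, add_sub_cancel_left, sub_add_cancel_left,
        ks]
    have a2 : ∫ z, {z : En n | ε ≤ ‖z‖}.indicator (fun z => (F x - F (x + z)) * k z) z
        = ∫ z, {z : En n | ε ≤ ‖z‖}.indicator (fun z => (F x - F (x - z)) * k z) z := by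
      rw [← integral_neg_eq_self]
      congr 1 with z
      simp only [indicator, mem_ofPred_eq, norm_neg, ks, ← sub_eq_add_neg]
    have bd : ∀ a b, |F a - F b| ≤ 2 * C := fun a b =>
      (abs_sub _ _).trans (by linarith [hC a, hC b])
    have i1 := intm ε hε (fun z => F x - F (x + z)) (by fun_prop) fun z => bd _ _
    have i2 := intm ε hε (fun z => F x - F (x - z)) (by fun_prop) fun z => bd _ _
    have a3 : ∫ z, {z : En n | ε ≤ ‖z‖}.indicator (fun z => symDiff n F x z * k z) z
        = (∫ z, {z : En n | ε ≤ ‖z‖}.indicator (fun z => (F x - F (x + z)) * k z) z)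
          + ∫ z, {z : En n | ε ≤ ‖z‖}.indicator (fun z => (F x - F (x - z)) * k z) z := by
      rw [← integral_add i1 i2]
      congr 1 with z
      simp only [indicator, symDiff]
      split_ifs
      · ring
      · simp
    rw [a1, a3, ← a2]
    ring
  have sc : Continuous (symDiff n F x) := by unfold symDiff; fun_prop
  have lim : Tendsto (fun ε : ℝ => ∫ z, {z : En n | ε ≤ ‖z‖}.indicator
      (fun z => symDiff n F x z * k z) z) (nhdsWithin 0 (Ioi 0))
      (nhds (∫ z, symDiff n F x z * k z)) := by
    refine tendsto_integral_filter_of_dominated_convergence _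
      (Eventually.of_forall fun ε =>
        ((sc.measurable.mul km).indicator (hset ε)).aestronglyMeasurable)
      (Eventually.of_forall fun ε => Eventually.of_forall fun z => ?_)
      (int0.const_mul (C' * |cns n s|)) (Eventually.of_forall fun z => ?_)
    · exact (norm_indicator_le_norm_self _ _).trans (hkb _ _ _ (hC' z))
    · rcases eq_or_ne z 0 with rfl | hz
      · have : symDiff n F x 0 = 0 := by simp [symDiff]; ring
        simp [indicator, this]
      · refine tendsto_const_nhds.congr' ?_
        have : ∀ᶠ ε : ℝ in nhdsWithin 0 (Ioi 0), ε < ‖z‖ :=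
          nhdsWithin_le_nhds (gt_mem_nhds (norm_pos_iff.2 hz))
        filter_upwards [this] with ε hε
        rw [indicator_of_mem (show z ∈ {z : En n | ε ≤ ‖z‖} from hε.le)]
  have lim2 := lim.const_mul (1 / 2)
  refine (Tendsto.congr' ?_ lim2).limUnder_eq
  filter_upwards [self_mem_nhdsWithin] with ε hε
  exact (e1 ε hε).symm

lemma cns_nonneg (hs0 : 0 < s) (hs1 : s < 1) : 0 ≤ cns n s := by
  unfold cns
  have h1 : 0 < Real.Gamma ((n:ℝ) / 2 + s) := Real.Gamma_pos_of_pos (by positivity)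
  have h2 : 0 < Real.Gamma (1 - s) := Real.Gamma_pos_of_pos (by linarith)
  have h3 := Real.pi_pos
  positivity

lemma integrable_mul_rpow (hn : 0 < n) (hs0 : 0 < s) (hs1 : s < 1) {T : En n → ℝ}
    (hT : Continuous T) {C : ℝ} (hC : ∀ z, |T z| ≤ C * min 1 (‖z‖ ^ 2)) :
    Integrable (fun z => T z * ‖z‖ ^ (-((n:ℝ) + 2 * s))) := by
  refine ((integrable_min_mul_rpow hn hs0 hs1).const_mul C).mono'
    (Measurable.aestronglyMeasurable (hT.measurable.mul (by fun_prop)))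
    (Eventually.of_forall fun z => ?_)
  have h0 : 0 ≤ ‖z‖ ^ (-((n:ℝ) + 2 * s)) := by positivity
  rw [Real.norm_eq_abs, abs_mul, abs_of_nonneg h0, ← mul_assoc]
  exact mul_le_mul_of_nonneg_right (hC z) h0

lemma integral_mul_rpow_nonneg (hn : 0 < n) (hs0 : 0 < s) (hs1 : s < 1) {T : En n → ℝ}
    (hT : Continuous T) {C : ℝ} (hC : ∀ z, |T z| ≤ C * min 1 (‖z‖ ^ 2))
    (h : ∀ ρ : ℝ, 0 < ρ → 0 ≤ ∫ z, T (ρ • z) ∂(gaussM n)) :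
    0 ≤ ∫ z, T z * ‖z‖ ^ (-((n:ℝ) + 2 * s)) := by
  set a : ℝ := ((n:ℝ) + 2 * s) / 2 with ha
  have ha0 : 0 < a := by positivity
  have hG : 0 < Real.Gamma a := Real.Gamma_pos_of_pos ha0
  have : Nonempty (Fin n) := ⟨⟨0, hn⟩⟩
  have hne : ∀ᵐ z : En n, z ≠ 0 := by
    simp [ae_iff]
  have hpow : ∀ z : En n, z ≠ 0 → ∫ t in Ioi (0:ℝ), t ^ (a - 1) * Real.exp (-(‖z‖ ^ 2 * t))
      = ‖z‖ ^ (-((n:ℝ) + 2 * s)) * Real.Gamma a := fun z hz => by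
    have hz : 0 < ‖z‖ := norm_pos_iff.2 hz
    rw [Real.integral_rpow_mul_exp_neg_mul_Ioi ha0 (by positivity), one_div,
      Real.inv_rpow (by positivity), ← Real.rpow_natCast, ← Real.rpow_mul hz.le,
      ← Real.rpow_neg hz.le]
    congr 2
    rw [ha]
    push_cast
    ring
  have hexp : ∀ z : En n, z ≠ 0 → Integrable
      (fun t : ℝ => t ^ (a - 1) * Real.exp (-(‖z‖ ^ 2 * t))) (volume.restrict (Ioi 0)) :=
    fun z hz => by
      refine Integrable.of_integral_ne_zero ?_
      rw [hpow z hz]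
      have hz : 0 < ‖z‖ := norm_pos_iff.2 hz
      positivity
  have T_int := integrable_mul_rpow hn hs0 hs1 hT hC
  have hprod : Integrable (Function.uncurry fun (z : En n) (t : ℝ) =>
      T z * (t ^ (a - 1) * Real.exp (-(‖z‖ ^ 2 * t)))) (volume.prod (volume.restrict (Ioi 0))) := by
    rw [integrable_prod_iff]
    · refine ⟨?_, ?_⟩
      · filter_upwards [hne] with z hz
        exact (hexp z hz).const_mul (T z)
      · refine (T_int.norm.mul_const (Real.Gamma a)).congr ?_
        filter_upwards [hne] with z hz
        have e : ∀ t ∈ Ioi (0:ℝ), ‖Function.uncurry (fun (z : En n) (t : ℝ) =>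
            T z * (t ^ (a - 1) * Real.exp (-(‖z‖ ^ 2 * t)))) (z, t)‖
            = |T z| * (t ^ (a - 1) * Real.exp (-(‖z‖ ^ 2 * t))) := fun t ht => by
          have ht : 0 < t := ht
          rw [Function.uncurry_apply_pair, norm_mul, Real.norm_eq_abs, Real.norm_of_nonneg]
          positivity
        rw [setIntegral_congr_fun measurableSet_Ioi e, integral_const_mul, hpow z hz,
          norm_mul, Real.norm_eq_abs, Real.norm_of_nonneg (by positivity)]
        ring
    · refine Measurable.aestronglyMeasurable ?_
      have := hT.measurable
      unfold Function.uncurry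
      fun_prop
  have hswap := integral_integral_swap hprod
  have hl : ∫ z, ∫ t in Ioi (0:ℝ), T z * (t ^ (a - 1) * Real.exp (-(‖z‖ ^ 2 * t)))
      = (∫ z, T z * ‖z‖ ^ (-((n:ℝ) + 2 * s))) * Real.Gamma a := by
    rw [← integral_mul_const]
    refine integral_congr_ae ?_
    filter_upwards [hne] with z hz
    rw [integral_const_mul, hpow z hz]
    ring
  rw [hl] at hswap
  refine le_of_mul_le_mul_right (a := Real.Gamma a) ?_ hG
  rw [zero_mul, hswap]
  refine setIntegral_nonneg measurableSet_Ioi fun t ht => ?_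
  have ht : 0 < t := ht
  have e2 : ∀ z, T z * (t ^ (a - 1) * Real.exp (-(‖z‖ ^ 2 * t)))
      = t ^ (a - 1) * (T z * Real.exp (-(‖z‖ ^ 2 * t))) := fun z => by ring
  simp only [e2]
  rw [integral_const_mul]
  refine mul_nonneg (by positivity) ?_
  set ρ : ℝ := (Real.sqrt (2 * t))⁻¹ with hρ
  have hρ0 : 0 < ρ := by positivity
  have h1 := h ρ hρ0
  have h2 : ∀ z : En n, T (ρ • z) * gaussWeight n z
      = (fun z => T z * Real.exp (-(‖z‖ ^ 2 * t))) (ρ • z) := fun z => by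
    dsimp only
    rw [gaussWeight, norm_smul, mul_pow, Real.norm_eq_abs, sq_abs, hρ, inv_pow,
      Real.sq_sqrt (by positivity)]
    congr 2
    field_simp
  rw [integral_gaussM] at h1
  have h4 := Measure.integral_comp_smul (volume : Measure (En n))
    (fun z => T z * Real.exp (-(‖z‖ ^ 2 * t))) ρ
  rw [integral_congr_ae (Eventually.of_forall h2), h4, smul_eq_mul] at h1
  have h3 := nonneg_of_mul_nonneg_right h1 (inv_pos.2 (gaussMass_pos n))
  exact nonneg_of_mul_nonneg_right h3 (by positivity)

end kernel

lemma integral_gaussM_quadratic {n : ℕ} (B : En n →L[ℝ] En n →L[ℝ] ℝ) :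
    ∫ z, B z z ∂(gaussM n)
      = ∑ i : Fin n, B (EuclideanSpace.single i 1) (EuclideanSpace.single i 1) := by
  have tc : ∀ l : En n →L[ℝ] ℝ, Tame n (fun z => l z) := fun l =>
    Tame.of_bound (C := ‖l‖) (k := 1) (by fun_prop) fun z => by
      refine (l.le_opNorm _).trans ?_
      gcongr
      simp
  have e1 : ∀ z : En n, B z z = ∑ i : Fin n,
      inner ℝ z (EuclideanSpace.single i 1) * B (EuclideanSpace.single i 1) z := fun z => by
    have hz : z = ∑ i : Fin n, inner ℝ z (EuclideanSpace.single i 1 : En n) •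
        (EuclideanSpace.single i 1 : En n) := by
      have := (EuclideanSpace.basisFun (Fin n) ℝ).sum_repr' z
      simp only [EuclideanSpace.basisFun_apply, real_inner_comm] at this
      exact this.symm
    have h2 : B z = ∑ i : Fin n, inner ℝ z (EuclideanSpace.single i 1 : En n) •
        B (EuclideanSpace.single i 1) := by
      conv_lhs => rw [hz]
      simp only [map_sum, map_smul]
    rw [h2]
    simp
  rw [integral_congr_ae (Eventually.of_forall e1), integral_finsetSum _ fun i _ => ((Tame.inner_right _).mul (tc _)).integrable]
  refine Finset.sum_congr rfl fun i _ => ?_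
  have h := gauss_stein (n := n) (f := fun _ => 1) (g := fun z => B (EuclideanSpace.single i 1) z)
    (EuclideanSpace.single i 1) (by fun_prop) (by fun_prop) (Tame.const _) (tc _)
    (by simpa using Tame.const 0) (by simpa using Tame.const _) 0
  simp only [one_mul, sub_zero, fderiv_fun_const, Pi.zero_apply, zero_apply,
    ContinuousLinearMap.fderiv, integral_const, probReal_univ, one_smul] at h
  rw [h]
  congr 1 with z
  ring

lemma SecondOrder.negLapInc_eq {n : ℕ} {F : En n → ℝ} {x : En n} {L : En n →L[ℝ] ℝ}
    {B : En n →L[ℝ] En n →L[ℝ] ℝ} (h : SecondOrder n F x L B) :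
    negLapInc n F x
      = ∑ i : Fin n, B (EuclideanSpace.single i 1) (EuclideanSpace.single i 1) :=
  (tendsto_finsetSum _ fun _ _ => h.lim _).liminf_eq

lemma integral_lim_nonneg {n : ℕ} {T b : En n → ℝ} (hT : Continuous T) {C : ℝ}
    (hC : ∀ z, |T z| ≤ C * min 1 (‖z‖ ^ 2))
    (hb : ∀ z, Tendsto (fun r : ℝ => T (r • z) / r ^ 2) (nhdsWithin 0 (Ioi 0)) (nhds (b z)))
    (h : ∀ ρ : ℝ, 0 < ρ → 0 ≤ ∫ z, T (ρ • z) ∂(gaussM n)) : 0 ≤ ∫ z, b z ∂(gaussM n) := by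
  have tn : Tame n (fun z => ‖z‖ ^ 2) :=
    Tame.of_bound (C := 1) (k := 2) (by fun_prop) fun z => by
      rw [abs_of_nonneg (by positivity), one_mul]
      gcongr
      simp
  refine ge_of_tendsto (tendsto_integral_filter_of_dominated_convergence
    (F := fun (r : ℝ) z => T (r • z) / r ^ 2) (fun z => |C| * ‖z‖ ^ 2)
    (Eventually.of_forall fun r => (by fun_prop :
      Continuous fun z : En n => T (r • z) / r ^ 2).aestronglyMeasurable)
    ?_ (((Tame.const |C|).mul tn).integrable) (Eventually.of_forall hb)) ?_
  · filter_upwards [self_mem_nhdsWithin] with r (hr : 0 < r)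
    refine Eventually.of_forall fun z => ?_
    rw [norm_div, Real.norm_eq_abs, Real.norm_of_nonneg (by positivity), div_le_iff₀ (by positivity)]
    calc |T (r • z)| ≤ C * min 1 (‖r • z‖ ^ 2) := hC _
      _ ≤ |C| * ‖r • z‖ ^ 2 := by
        gcongr
        · exact le_abs_self C
        · exact min_le_right _ _
      _ = _ := by rw [norm_smul, Real.norm_of_nonneg hr.le]; ring
  · filter_upwards [self_mem_nhdsWithin] with r (hr : 0 < r)
    rw [integral_div]
    exact div_nonneg (h r hr) (by positivity)

lemma integral_three_smul_sub {α : Type*} [MeasurableSpace α] {μ : Measure α}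
    {f₁ f₂ f₃ f₄ : α → ℝ} (i₁ : Integrable f₁ μ) (i₂ : Integrable f₂ μ) (i₃ : Integrable f₃ μ)
    (i₄ : Integrable f₄ μ) {a₁ a₂ a₃ : ℝ} :
    ∫ z, (a₁ * f₁ z + a₂ * f₂ z + a₃ * f₃ z - f₄ z) ∂μ
      = a₁ * ∫ z, f₁ z ∂μ + a₂ * ∫ z, f₂ z ∂μ + a₃ * ∫ z, f₃ z ∂μ - ∫ z, f₄ z ∂μ := by
  have j₁ := i₁.const_mul a₁
  have j₂ := i₂.const_mul a₂
  have j₃ := i₃.const_mul a₃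
  have j₁₂ : Integrable (fun z => a₁ * f₁ z + a₂ * f₂ z) μ := j₁.add j₂
  have j₁₂₃ : Integrable (fun z => a₁ * f₁ z + a₂ * f₂ z + a₃ * f₃ z) μ := j₁₂.add j₃
  rw [integral_sub j₁₂₃ i₄, integral_add j₁₂ j₃, integral_add j₁ j₂, integral_const_mul,
    integral_const_mul, integral_const_mul]

namespace AuxData
variable {n : ℕ} {η ηb : En n → ℝ} {M M' : ℝ} {u : En n → ℝ} {Mu : ℝ} {e : En n}

lemma exists_secondOrder_auxPhi (h : AuxData n η ηb M M' u Mu) (e : En n) (R κ τ σ : ℝ)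
    (x : En n) : ∃ L B, SecondOrder n (auxPhi n η ηb u e R κ τ σ) x L B := by
  have c0 := h.hη
  have c1 := h.hηb
  have c2 := h.hu
  have c3 := contDiff_dd h.hu e
  obtain ⟨L₁, B₁, h₁⟩ := SecondOrder.of_contDiff (contDiff_dd2 h.hu e) x
  obtain ⟨L₂, B₂, h₂⟩ := h₁.pos_part_sq
  obtain ⟨L₃, B₃, h₃⟩ := SecondOrder.of_contDiff
    (F := fun y => (ηb (R⁻¹ • y))^2) (by fun_prop) x
  obtain ⟨L₄, B₄, h₄⟩ := SecondOrder.of_contDiff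
    (F := fun y => τ / R^2 * (η ((2*R)⁻¹ • y))^2 * (dd n e u y)^2 + σ / R^4 * (u y - κ)^2)
    (by fun_prop) x
  refine ⟨_, _, ((h₃.mul h₂).add h₄).congr (Eventually.of_forall fun y => ?_)⟩
  simp only [auxPhi]
  ring

lemma fracLapE_auxPhi_le (hn : 0 < n) (h : AuxData n η ηb M M' u Mu) (he : ‖e‖ = 1) {R : ℝ}
    (hR : 0 < R) {κ τ σ : ℝ} (hτ : 52 * gaussK n ^ 2 * (1 + |M| + |M'|) ^ 2 ≤ τ)
    (hσ : 2500 * gaussK n ^ 4 * (1 + |M| + |M'|) ^ 4 * τ ≤ σ) {s : ℝ} (hs : s ∈ Icc (0:ℝ) 1)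
    (x : En n) :
    fracLapE n s (auxPhi n η ηb u e R κ τ σ) x ≤
      2 * (ηb (R⁻¹ • x))^2 * max (dd2 n e u x) 0 * fracLapE n s (dd2 n e u) x
        + 2 * τ / R^2 * (η ((2*R)⁻¹ • x))^2 * dd n e u x * fracLapE n s (dd n e u) x
        + 2 * σ / R^4 * (u x - κ) * fracLapE n s (fun y => u y - κ) x := by
  have hτ0 : 0 ≤ τ := le_trans (by positivity) hτ
  have hσ0 : 0 ≤ σ := le_trans (by positivity) hσ
  rcases eq_or_ne s 0 with rfl | hs0
  · simp only [fracLapE, if_true]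
    have e1 : max (dd2 n e u x) 0 * dd2 n e u x = max (dd2 n e u x) 0 ^ 2 := by
      rcases max_cases (dd2 n e u x) 0 with ⟨h, _⟩ | ⟨h, _⟩ <;> rw [h] <;> ring
    have e2 : 2 * (ηb (R⁻¹ • x))^2 * max (dd2 n e u x) 0 * dd2 n e u x
        + 2 * τ / R^2 * (η ((2*R)⁻¹ • x))^2 * dd n e u x * dd n e u x
        + 2 * σ / R^4 * (u x - κ) * (u x - κ) = 2 * auxPhi n η ηb u e R κ τ σ x := by
      rw [mul_assoc _ (max _ _), e1, auxPhi]
      ring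
    rw [e2]
    have : 0 ≤ auxPhi n η ηb u e R κ τ σ x := by
      unfold auxPhi
      positivity
    linarith
  have c1 := h.hu.continuous
  have c2 := (contDiff_dd h.hu e).continuous
  have c3 := (contDiff_dd2 h.hu e).continuous
  have c4 := h.continuous_auxPhi e R κ τ σ
  have c5 : Continuous (fun y => u y - κ) := c1.sub continuous_const
  have bk : ∀ y, |u y - κ| ≤ Mu + |κ| := fun y =>
    (abs_sub _ _).trans (by linarith [(h.bu y).1])
  have hheat := fun (ρ : ℝ) (hρ : 0 < ρ) => h.integral_symDiff_nonneg he hR (κ := κ) hτ hσ x hρ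
  obtain ⟨L₁, B₁, r₁⟩ := SecondOrder.of_contDiff (contDiff_dd2 h.hu e) x
  obtain ⟨L₂, B₂, r₂⟩ := SecondOrder.of_contDiff (contDiff_dd h.hu e) x
  obtain ⟨L₃, B₃, r₃⟩ := SecondOrder.of_contDiff (F := fun y => u y - κ)
    (h.hu.sub contDiff_const) x
  obtain ⟨L₄, B₄, r₄⟩ := h.exists_secondOrder_auxPhi e R κ τ σ x
  have b₁ := h.abs_dd2_le he
  have b₂ := h.abs_dd_le he
  have b₄ := h.abs_auxPhi_le he R κ τ σ
  obtain ⟨C₁, k₁⟩ := r₁.exists_symDiff_le b₁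
  obtain ⟨C₂, k₂⟩ := r₂.exists_symDiff_le b₂
  obtain ⟨C₃, k₃⟩ := r₃.exists_symDiff_le bk
  obtain ⟨C₄, k₄⟩ := r₄.exists_symDiff_le b₄
  have sc : ∀ F : En n → ℝ, Continuous F → Continuous (symDiff n F x) := fun F hF => by
    unfold symDiff; fun_prop
  have s₁ := sc _ c3
  have s₂ := sc _ c2
  have s₃ := sc _ c5
  have s₄ := sc _ c4
  set a₁ := 2 * (ηb (R⁻¹ • x))^2 * max (dd2 n e u x) 0
  set a₂ := 2 * τ / R^2 * (η ((2*R)⁻¹ • x))^2 * dd n e u x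
  set a₃ := 2 * σ / R^4 * (u x - κ)
  set T : En n → ℝ := fun z => a₁ * symDiff n (dd2 n e u) x z + a₂ * symDiff n (dd n e u) x z
    + a₃ * symDiff n (fun y => u y - κ) x z - symDiff n (auxPhi n η ηb u e R κ τ σ) x z with hT
  have Tc : Continuous T := by fun_prop
  have Tb : ∀ z, |T z| ≤ (|a₁| * C₁ + |a₂| * C₂ + |a₃| * C₃ + C₄) * min 1 (‖z‖ ^ 2) := fun z => by
    refine (abs_sub _ _).trans ((add_le_add_left (abs_add_three _ _ _) _).trans ?_)
    simp only [abs_mul]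
    have m₁ := mul_le_mul_of_nonneg_left (k₁ z) (abs_nonneg a₁)
    have m₂ := mul_le_mul_of_nonneg_left (k₂ z) (abs_nonneg a₂)
    have m₃ := mul_le_mul_of_nonneg_left (k₃ z) (abs_nonneg a₃)
    linarith [k₄ z]
  rcases eq_or_ne s 1 with rfl | hs1
  · simp only [fracLapE, one_ne_zero, if_true, if_false]
    rw [r₁.negLapInc_eq, r₂.negLapInc_eq, r₃.negLapInc_eq, r₄.negLapInc_eq]
    have key := integral_lim_nonneg Tc Tb
      (b := fun z => (a₁ • B₁ + a₂ • B₂ + a₃ • B₃ - B₄ : En n →L[ℝ] En n →L[ℝ] ℝ) z z)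
      (fun z => ((((r₁.lim z).const_mul a₁).add ((r₂.lim z).const_mul a₂)).add
        ((r₃.lim z).const_mul a₃)).sub (r₄.lim z) |>.congr fun r => by
          simp only [hT]; ring) hheat
    rw [integral_gaussM_quadratic] at key
    simp only [sub_apply, add_apply, smul_apply, smul_eq_mul, Finset.sum_sub_distrib,
      Finset.sum_add_distrib, ← Finset.mul_sum] at key
    linarith
  · have hp : 0 < s := lt_of_le_of_ne hs.1 (Ne.symm hs0)
    have hl : s < 1 := lt_of_le_of_ne hs.2 hs1
    simp only [fracLapE, if_neg hs0, if_neg hs1]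
    rw [fracLap_eq hn hp hl c3 b₁ k₁, fracLap_eq hn hp hl c2 b₂ k₂, fracLap_eq hn hp hl c5 bk k₃,
      fracLap_eq hn hp hl c4 b₄ k₄]
    simp only [mul_left_comm _ (cns n s), integral_const_mul]
    have key := integral_mul_rpow_nonneg hn hp hl Tc Tb hheat
    have i₁ := integrable_mul_rpow hn hp hl s₁ k₁
    have i₂ := integrable_mul_rpow hn hp hl s₂ k₂
    have i₃ := integrable_mul_rpow hn hp hl s₃ k₃
    have i₄ := integrable_mul_rpow hn hp hl s₄ k₄
    have e1 : ∀ z, T z * ‖z‖ ^ (-((n:ℝ) + 2 * s))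
        = a₁ * (symDiff n (dd2 n e u) x z * ‖z‖ ^ (-((n:ℝ) + 2 * s)))
        + a₂ * (symDiff n (dd n e u) x z * ‖z‖ ^ (-((n:ℝ) + 2 * s)))
        + a₃ * (symDiff n (fun y => u y - κ) x z * ‖z‖ ^ (-((n:ℝ) + 2 * s)))
        - symDiff n (auxPhi n η ηb u e R κ τ σ) x z * ‖z‖ ^ (-((n:ℝ) + 2 * s)) := fun z => by
      simp only [hT]; ring
    rw [integral_congr_ae (Eventually.of_forall e1),
      integral_three_smul_sub i₁ i₂ i₃ i₄] at key
    have := mul_nonneg (mul_nonneg (show (0:ℝ) ≤ 1 / 2 by norm_num) (cns_nonneg (n := n) hp hl)) key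
    linarith

end AuxData

/-- key inequality for the full auxiliary function
`φ = η̄_R² ((∂²_e u)₊)² + τ R⁻² η_R² (∂_e u)² + σ R⁻⁴ (u−κ)²`, for all `s ∈ [0,1]`,
with constants `τ₀`, `σ₀` depending only on `n`, `‖η‖_{C²}`, `‖η̄‖_{C²}`. -/
theorem key_inequality_full_auxiliary_function (n : ℕ) (hn : 0 < n) :
    ∃ σ₀ τ₀ : ℝ → ℝ → ℝ,
      (∀ M M' : ℝ, 0 < σ₀ M M' ∧ 0 < τ₀ M M') ∧
      ∀ (η ηb : En n → ℝ),
        -- `η, η̄ ∈ C_c^∞(B_{1/2})`, `η = 1` on `B_{1/4}`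
        ContDiff ℝ (⊤ : ℕ∞) η → HasCompactSupport η →
        tsupport η ⊆ ball (0 : En n) (1/2) →
        (∀ x ∈ ball (0 : En n) (1/4), η x = 1) →
        ContDiff ℝ (⊤ : ℕ∞) ηb → HasCompactSupport ηb →
        tsupport ηb ⊆ ball (0 : En n) (1/2) →
      ∀ (M M' : ℝ), C2BddBy n η M → C2BddBy n ηb M' →
      ∀ (R : ℝ), 0 < R →
      ∀ (s : ℝ), s ∈ Set.Icc (0:ℝ) 1 →
      ∀ (κ : ℝ) (e : En n), ‖e‖ = 1 →
      ∀ (u : En n → ℝ), ContDiff ℝ (⊤ : ℕ∞) u →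
        (∃ Mu : ℝ, ∀ x, |u x| ≤ Mu ∧ ‖fderiv ℝ u x‖ ≤ Mu ∧ ‖fderiv ℝ (fderiv ℝ u) x‖ ≤ Mu) →
      ∀ (τ σ : ℝ), τ₀ M M' ≤ τ → σ₀ M M' * τ ≤ σ →
      ∀ x : En n,
        fracLapE n s
          (fun y => (ηb (R⁻¹ • y))^2 * (max (dd2 n e u y) 0)^2
            + τ / R^2 * (η ((2*R)⁻¹ • y))^2 * (dd n e u y)^2
            + σ / R^4 * (u y - κ)^2) x ≤
        2 * (ηb (R⁻¹ • x))^2 * max (dd2 n e u x) 0 * fracLapE n s (dd2 n e u) x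
          + 2 * τ / R^2 * (η ((2*R)⁻¹ • x))^2 * dd n e u x * fracLapE n s (dd n e u) x
          + 2 * σ / R^4 * (u x - κ) * fracLapE n s (fun y => u y - κ) x := by
  have hK : 0 < gaussK n := one_pos.trans_le (one_le_gaussK n)
  refine ⟨fun M M' => 2500 * gaussK n ^ 4 * (1 + |M| + |M'|) ^ 4,
    fun M M' => 52 * gaussK n ^ 2 * (1 + |M| + |M'|) ^ 2,
    fun M M' => ⟨by positivity, by positivity⟩, ?_⟩
  rintro η ηb hη - - hone hηb - hsupp M M' bη bηb R hR s hs κ e he u hu ⟨Mu, hMu⟩ τ σ hτ hσ x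
  exact (AuxData.mk hη hone hηb hsupp bη bηb hu hMu).fracLapE_auxPhi_le hn he hR hτ hσ hs x
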